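/- arXiv:2404.06368 — 3 statements merged into one kernel-verified Lean document; each statement's English description precedes it below -/
import Mathlib

section
/- Let 𝕜 be a field, A a unital associative 𝕜-algebra, B a commutative unital 𝕜-algebra, and ε : B → A a morphism of 𝕜-algebras with ε(B) ⊆ 𝒵(A) (the center of A). Setting 𝒜_n = A ⊗ B^{⊗2n+1} ⊗ A^{op} for all n ≥ 0, with face maps δ_0^𝒜(a⊗α_1⊗⋯⊗α_n⊗γ⊗β_1⊗⋯⊗β_n⊗b) = aε(α_1)⊗α_2⊗⋯⊗α_n⊗γβ_1⊗β_2⊗⋯⊗β_n⊗b, δ_i^𝒜 multiplying α_iα_{i+1} and β_iβ_{i+1} for 1 ≤ i ≤ n−1, δ_n^𝒜(a⊗α_1⊗⋯⊗α_n⊗γ⊗β_1⊗⋯⊗β_n⊗b) = a⊗α_1⊗⋯⊗α_{n−1}⊗α_nγ⊗β_1⊗⋯⊗β_{n−1}⊗ε(β_n)b, and degeneracy maps σ_i^𝒜 inserting 1's in the corresponding positions (σ_0 inserts 1 after a and after γ; σ_i for 1≤i≤n−1 inserts 1 after α_i and after β_i; σ_n inserts 1 after α_n and after β_n), the data 𝒜(A,B,ε)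 = ({𝒜_n}, δ_i^𝒜, σ_i^𝒜) is a simplicial 𝕜-algebra: each δ_i^𝒜 and σ_i^𝒜 is a morphism of 𝕜-algebras and they satisfy the simplicial identities. -/
open scoped TensorProduct
open MulOpposite PiTensorProduct

/-- A simplicial `k`-algebra: a collection of `k`-algebras `A n` with face maps
`δ n i : A (n+1) →ₐ[k] A n` (for `0 ≤ i ≤ n+1`) and degeneracy maps
`σ n i : A n →ₐ[k] A (n+1)` (for `0 ≤ i ≤ n`) satisfying the simplicial identities. -/
structure SimplicialAlgebra (k : Type) [Field k] (A : ℕ → Type)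
    [∀ n, Ring (A n)] [∀ n, Algebra k (A n)] where
  δ : (n : ℕ) → ℕ → (A (n + 1) →ₐ[k] A n)
  σ : (n : ℕ) → ℕ → (A n →ₐ[k] A (n + 1))
  δδ : ∀ n i j, i < j → j ≤ n + 2 → ∀ a, δ n i (δ (n + 1) j a) = δ n (j - 1) (δ (n + 1) i a)
  σσ : ∀ n i j, i ≤ j → j ≤ n → ∀ a, σ (n + 1) i (σ n j a) = σ (n + 1) (j + 1) (σ n i a)
  δσ_lt : ∀ n i j, i < j → j ≤ n + 1 → ∀ a, δ (n + 1) i (σ (n + 1) j a) = σ n (j - 1) (δ n i a)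
  δσ_eq : ∀ n i j, (i = j ∨ i = j + 1) → j ≤ n → ∀ a, δ n i (σ n j a) = a
  δσ_gt : ∀ n i j, j + 1 < i → i ≤ n + 2 → ∀ a, δ (n + 1) i (σ (n + 1) j a) = σ n j (δ n (i - 1) a)


/-- The `0`-th face of `𝒜(A,B,ε)` on the `B`-tensor factors: drop `α₁` (which is
multiplied into `a` via `ε`) and replace `γ, β₁` by `γβ₁`. -/
def secFace0 {B : Type} [CommRing B] (n : ℕ) (v : Fin (2 * n + 3) → B) :
    Fin (2 * n + 1) → B :=
  fun m =>
    if (m : ℕ) < n then v ⟨(m : ℕ) + 1, by omega⟩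
    else if (m : ℕ) = n then v ⟨n + 1, by omega⟩ * v ⟨n + 2, by omega⟩
    else v ⟨(m : ℕ) + 2, by omega⟩

/-- The `i`-th face (for `1 ≤ i ≤ n`) of `𝒜(A,B,ε)` on the `B`-tensor factors:
multiply `αᵢα_{i+1}` and `βᵢβ_{i+1}`. -/
def secFaceMid {B : Type} [CommRing B] (n i : ℕ) (v : Fin (2 * n + 3) → B) :
    Fin (2 * n + 1) → B :=
  fun m =>
    if (m : ℕ) < i - 1 then v ⟨m, by omega⟩
    else if (m : ℕ) = i - 1 then v ⟨m, by omega⟩ * v ⟨(m : ℕ) + 1, by omega⟩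
    else if (m : ℕ) < n + i then v ⟨(m : ℕ) + 1, by omega⟩
    else if (m : ℕ) = n + i then v ⟨(m : ℕ) + 1, by omega⟩ * v ⟨(m : ℕ) + 2, by omega⟩
    else v ⟨(m : ℕ) + 2, by omega⟩

/-- The last face of `𝒜(A,B,ε)` on the `B`-tensor factors: replace `αₙ₊₁, γ` by
`αₙ₊₁γ` and drop `βₙ₊₁` (which is multiplied into `b` via `ε`). -/
def secFaceLast {B : Type} [CommRing B] (n : ℕ) (v : Fin (2 * n + 3) → B) :
    Fin (2 * n + 1) → B :=
  fun m =>
    if (m : ℕ) < n then v ⟨m, by omega⟩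
    else if (m : ℕ) = n then v ⟨n, by omega⟩ * v ⟨n + 1, by omega⟩
    else v ⟨(m : ℕ) + 1, by omega⟩

/-- The `i`-th degeneracy of `𝒜(A,B,ε)` on the `B`-tensor factors: insert a `1` after
`αᵢ` and after `βᵢ`. -/
def secDegen {B : Type} [CommRing B] (n i : ℕ) (hi : i ≤ n) (v : Fin (2 * n + 1) → B) :
    Fin (2 * n + 3) → B :=
  fun m =>
    if h : (m : ℕ) < i then v ⟨m, by omega⟩
    else if (m : ℕ) = i then 1
    else if h2 : (m : ℕ) < n + 2 + i then v ⟨(m : ℕ) - 1, by omega⟩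
    else if (m : ℕ) = n + 2 + i then 1
    else v ⟨(m : ℕ) - 2, by omega⟩

noncomputable section

namespace SecondaryHochschild

variable (k A B D : Type) [Field k] [Ring A] [Algebra k A] [CommRing B] [Algebra k B]
  [Ring D] [Algebra k D]

/-- The algebra `B^{⊗(2n+1)}`. -/
def Mid (n : ℕ) : Type := ⨂[k] (_ : Fin (2 * n + 1)), B

instance (n : ℕ) : CommRing (Mid k B n) :=
  inferInstanceAs (CommRing (⨂[k] (_ : Fin (2 * n + 1)), B))

instance (n : ℕ) : Algebra k (Mid k B n) :=
  inferInstanceAs (Algebra k (⨂[k] (_ : Fin (2 * n + 1)), B))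

/-- Pure tensors, as a multiplicative map. -/
def pureTensor (n : ℕ) : (Fin (2 * n + 1) → B) →* Mid k B n :=
  tprodMonoidHom k

/-- The inclusion of `B` as the `j`-th factor of `B^{⊗(2n+1)}`. -/
def single (n : ℕ) (j : Fin (2 * n + 1)) : B →ₐ[k] Mid k B n :=
  singleAlgHom (R := k) (A := fun _ : Fin (2 * n + 1) => B) j

theorem single_apply (n : ℕ) (j : Fin (2 * n + 1)) (x : B) :
    single k B n j x = pureTensor k B n (Pi.mulSingle j x) := rfl

variable {k B} in
theorem mid_algHom_ext {n : ℕ} {C : Type} [Semiring C] [Algebra k C] {F G : Mid k B n →ₐ[k] C}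
    (h : ∀ j x, F (single k B n j x) = G (single k B n j x)) : F = G :=
  PiTensorProduct.algHom_ext (R := k) (A := fun _ : Fin (2 * n + 1) => B)
    fun j => AlgHom.ext (h j)

variable {k B} in
/-- The morphism out of `B^{⊗(2n+1)}` given by a family of morphisms out of `B`. -/
def midLift {n : ℕ} {C : Type} [CommRing C] [Algebra k C]
    (F : Fin (2 * n + 1) → B →ₐ[k] C) : Mid k B n →ₐ[k] C :=
  liftAlgHom (R := k) (A := fun _ : Fin (2 * n + 1) => B)
    ((MultilinearMap.mkPiAlgebra k (Fin (2 * n + 1)) C).compLinearMap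
      fun j => (F j).toLinearMap)
    (by simp) (by simp [Finset.prod_mul_distrib])

variable {k B} in
theorem midLift_pure {n : ℕ} {C : Type} [CommRing C] [Algebra k C]
    (F : Fin (2 * n + 1) → B →ₐ[k] C) (v : Fin (2 * n + 1) → B) :
    midLift F (pureTensor k B n v) = ∏ j, F j (v j) :=
  PiTensorProduct.lift.tprod (R := k) (s := fun _ : Fin (2 * n + 1) => B) v

/-- The algebra `A ⊗ B^{⊗(2n+1)} ⊗ D`. -/
abbrev Obj (n : ℕ) : Type := A ⊗[k] (Mid k B n ⊗[k] D)

/-- The commutative algebra `B ⊗ B^{⊗(2n+1)} ⊗ B`, whose `2n+3` factors are numbered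
by the positions `0, …, 2n+2`. -/
abbrev Coeff (n : ℕ) : Type := B ⊗[k] (Mid k B n ⊗[k] B)

/-- The inclusion of `B` in position `p`; all positions from `2n+2` on mean the last one. -/
def incl (n p : ℕ) : B →ₐ[k] Coeff k B n :=
  if p = 0 then Algebra.TensorProduct.includeLeft
  else if h : p - 1 < 2 * n + 1 then
    Algebra.TensorProduct.includeRight.comp
      (Algebra.TensorProduct.includeLeft.comp (single k B n ⟨p - 1, h⟩))
  else Algebra.TensorProduct.includeRight.comp Algebra.TensorProduct.includeRight

variable {k A B D}

theorem incl_zero (n : ℕ) (x : B) : incl k B n 0 x = x ⊗ₜ 1 := by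
  simp [incl]

theorem incl_succ (n : ℕ) (j : Fin (2 * n + 1)) (x : B) :
    incl k B n (j + 1) x = 1 ⊗ₜ (single k B n j x ⊗ₜ 1) := by
  rw [incl, if_neg (Nat.succ_ne_zero _), dif_pos (by simpa using j.isLt)]
  rfl

theorem incl_last (n : ℕ) (x : B) : incl k B n (2 * n + 2) x = 1 ⊗ₜ (1 ⊗ₜ x) := by
  simp [incl]

theorem prod_incl (n : ℕ) (w : ℕ → B) :
    ∏ p ∈ Finset.range (2 * n + 3), incl k B n p (w p) =
      w 0 ⊗ₜ (pureTensor k B n (fun j : Fin (2 * n + 1) => w (j + 1)) ⊗ₜ w (2 * n + 2)) := by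
  have hmid : ∏ j : Fin (2 * n + 1), incl k B n (j + 1) (w (j + 1)) =
      1 ⊗ₜ (pureTensor k B n (fun j : Fin (2 * n + 1) => w (j + 1)) ⊗ₜ 1) := by
    have hw : (fun j : Fin (2 * n + 1) => w (j + 1)) =
        ∏ j : Fin (2 * n + 1), Pi.mulSingle j (w (j + 1)) :=
      (Finset.univ_prod_mulSingle _).symm
    simp only [incl_succ]
    rw [hw, map_prod]
    exact (map_prod ((Algebra.TensorProduct.includeRight :
      _ →ₐ[k] Coeff k B n).comp Algebra.TensorProduct.includeLeft) _ _).symm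
  rw [Finset.prod_range_succ, Finset.prod_range_succ', incl_zero, incl_last,
    ← Fin.prod_univ_eq_prod_range (fun p => incl k B n (p + 1) (w (p + 1))), hmid]
  simp [Algebra.TensorProduct.tmul_mul_tmul]

variable (ε : B →ₐ[k] A) (η : B →ₐ[k] D)

/-- The morphism `B ⊗ B^{⊗(2n+1)} ⊗ B → A ⊗ B^{⊗(2n+1)} ⊗ D` given by `ε` and `η` on
the outer factors. -/
def coeffMap (n : ℕ) : Coeff k B n →ₐ[k] Obj k A B D n :=
  Algebra.TensorProduct.map ε
    (Algebra.TensorProduct.map (AlgHom.id k _) η)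

theorem coeffMap_tmul (n : ℕ) (x y : B) (t : Mid k B n) :
    coeffMap ε η n (x ⊗ₜ (t ⊗ₜ y)) = ε x ⊗ₜ (t ⊗ₜ η y) := rfl

theorem commute_coeffMap (hε : ∀ (β : B) (x : A), ε β * x = x * ε β)
    (hη : ∀ (β : B) (x : D), η β * x = x * η β) (n : ℕ) (r : Coeff k B n) (z : Obj k A B D n) :
    Commute (coeffMap ε η n r) z := by
  induction r using TensorProduct.induction_on with
  | zero => simp
  | add _ _ h₁ h₂ => simpa using h₁.add_left h₂
  | tmul x s =>
    rw [coeffMap, Algebra.TensorProduct.map_tmul]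
    induction z using TensorProduct.induction_on with
    | zero => simp
    | add _ _ h₁ h₂ => exact h₁.add_right h₂
    | tmul a c =>
      refine Commute.tmul (hε x a) ?_
      induction s using TensorProduct.induction_on with
      | zero => simp
      | add _ _ h₁ h₂ => simpa using h₁.add_left h₂
      | tmul t y =>
        rw [Algebra.TensorProduct.map_tmul]
        induction c using TensorProduct.induction_on with
        | zero => simp
        | add _ _ h₁ h₂ => exact h₁.add_right h₂
        | tmul u b =>
          exact Commute.tmul (mul_comm _ _) (hη y b)

/-- The morphism `B^{⊗(2m+1)} → B ⊗ B^{⊗(2n+1)} ⊗ B` moving the factor in position `p`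
to position `f p`. -/
def transport (m n : ℕ) (f : ℕ → ℕ) :
    Mid k B m →ₐ[k] Coeff k B n :=
  midLift fun j => incl k B n (f (j + 1))

theorem transport_pure (m n : ℕ) (f : ℕ → ℕ) (v : Fin (2 * m + 1) → B) :
    transport m n f (pureTensor k B m v) = ∏ j : Fin (2 * m + 1), incl k B n (f (j + 1)) (v j) :=
  midLift_pure _ _

theorem transport_single (m n : ℕ) (f : ℕ → ℕ) (j : Fin (2 * m + 1)) (x : B) :
    transport m n f (single k B m j x) = incl k B n (f (j + 1)) x := by
  rw [single_apply, transport_pure, Finset.prod_eq_single j]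
  · simp
  · intro i _ hij
    simp [hij]
  · simp

theorem transport_pure_eq_tmul (m n : ℕ) (f : ℕ → ℕ)
    (hf : ∀ j : Fin (2 * m + 1), f (j + 1) ≤ 2 * n + 2) (v : Fin (2 * m + 1) → B)
    (u : Fin (2 * n + 1) → B)
    (hu : ∀ i : Fin (2 * n + 1), ∏ j : Fin (2 * m + 1) with f (j.val + 1) = i.val + 1, v j = u i) :
    transport m n f (pureTensor k B m v) =
      (∏ j : Fin (2 * m + 1) with f (j.val + 1) = 0, v j) ⊗ₜ (pureTensor k B n u ⊗ₜ
        ∏ j : Fin (2 * m + 1) with f (j.val + 1) = 2 * n + 2, v j) := by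
  obtain rfl := funext hu
  rw [transport_pure,
    ← prod_incl n fun p => ∏ j : Fin (2 * m + 1) with f (j.val + 1) = p, v j, ← Finset.prod_fiberwise_of_maps_to
    (t := Finset.range (2 * n + 3)) (g := fun j : Fin (2 * m + 1) => f (j + 1))
    (fun j _ => Finset.mem_range.2 (Nat.lt_succ_of_le (hf j)))]
  refine Finset.prod_congr rfl fun p _ => ?_
  rw [map_prod]
  refine Finset.prod_congr rfl fun j hj => ?_
  rw [(Finset.mem_filter.1 hj).2]

variable (hε : ∀ (β : B) (x : A), ε β * x = x * ε β) (hη : ∀ (β : B) (x : D), η β * x = x * η β)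

/-- The morphism `A ⊗ B^{⊗(2m+1)} ⊗ D → A ⊗ B^{⊗(2n+1)} ⊗ D` which is the identity on
the outer factors and moves the factor in position `p` to position `f p`. -/
def move (m n : ℕ) (f : ℕ → ℕ) : Obj k A B D m →ₐ[k] Obj k A B D n :=
  Algebra.TensorProduct.lift Algebra.TensorProduct.includeLeft
    (Algebra.TensorProduct.lift ((coeffMap ε η n).comp (transport m n f))
      (Algebra.TensorProduct.includeRight.comp Algebra.TensorProduct.includeRight)
      fun _ _ => commute_coeffMap ε η hε hη n _ _)
    fun a s => by
      induction s using TensorProduct.induction_on with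
      | zero => simp
      | add _ _ h₁ h₂ => simpa using h₁.add_right h₂
      | tmul t b =>
        change Commute _ (coeffMap ε η n (transport m n f t) * 1 ⊗ₜ (1 ⊗ₜ b))
        refine (commute_coeffMap ε η hε hη n _ _).symm.mul_right ?_
        exact Commute.tmul (Commute.one_right a) (Commute.one_left _)

theorem move_tmul (m n : ℕ) (f : ℕ → ℕ) (a : A) (t : Mid k B m)
    (b : D) :
    move ε η hε hη m n f (a ⊗ₜ (t ⊗ₜ b)) =
      a ⊗ₜ 1 * (coeffMap ε η n (transport m n f t) * 1 ⊗ₜ (1 ⊗ₜ b)) := rfl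

theorem move_pure (m n : ℕ) (f : ℕ → ℕ)
    (hf : ∀ j : Fin (2 * m + 1), f (j + 1) ≤ 2 * n + 2) (a : A) (b : D)
    (v : Fin (2 * m + 1) → B) (x y : B) (u : Fin (2 * n + 1) → B)
    (hx : ∏ j : Fin (2 * m + 1) with f (j.val + 1) = 0, v j = x)
    (hu : ∀ i : Fin (2 * n + 1), ∏ j : Fin (2 * m + 1) with f (j.val + 1) = i.val + 1, v j = u i)
    (hy : ∏ j : Fin (2 * m + 1) with f (j.val + 1) = 2 * n + 2, v j = y) :
    move ε η hε hη m n f (a ⊗ₜ (pureTensor k B m v ⊗ₜ b)) =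
      (a * ε x) ⊗ₜ (pureTensor k B n u ⊗ₜ (b * η y)) := by
  rw [move_tmul, transport_pure_eq_tmul m n f hf v u hu, hx, hy, coeffMap_tmul]
  simp [Algebra.TensorProduct.tmul_mul_tmul, hη]

theorem move_outer (m n : ℕ) (f : ℕ → ℕ) (a : A) (b : D) :
    move ε η hε hη m n f (a ⊗ₜ (1 ⊗ₜ b)) = a ⊗ₜ (1 ⊗ₜ b) := by
  rw [move_tmul, map_one, map_one, one_mul]
  simp [Algebra.TensorProduct.tmul_mul_tmul, Algebra.TensorProduct.one_def]

theorem move_single (m n : ℕ) (f : ℕ → ℕ) (j : Fin (2 * m + 1)) (x : B) :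
    move ε η hε hη m n f (1 ⊗ₜ (single k B m j x ⊗ₜ 1)) =
      coeffMap ε η n (incl k B n (f (j + 1)) x) := by
  rw [move_tmul, transport_single]
  simp only [← Algebra.TensorProduct.one_def, one_mul, mul_one]

theorem move_coeffMap_incl (m n : ℕ) (f : ℕ → ℕ) (h₀ : f 0 = 0)
    (h₁ : f (2 * m + 2) = 2 * n + 2) (p : ℕ) (hp : p ≤ 2 * m + 2) (x : B) :
    move ε η hε hη m n f (coeffMap ε η m (incl k B m p x)) =
      coeffMap ε η n (incl k B n (f p) x) := by
  obtain rfl | ⟨j, rfl⟩ | rfl :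
      p = 0 ∨ (∃ j : Fin (2 * m + 1), p = j + 1) ∨ p = 2 * m + 2 := by
    by_cases h : p - 1 < 2 * m + 1
    · by_cases h' : p = 0
      · exact .inl h'
      · exact .inr (.inl ⟨⟨p - 1, h⟩, by simp; omega⟩)
    · omega
  · rw [h₀, incl_zero, incl_zero, Algebra.TensorProduct.one_def, Algebra.TensorProduct.one_def,
      coeffMap_tmul, coeffMap_tmul, move_outer]
  · rw [incl_succ, coeffMap_tmul, map_one, map_one, move_single]
  · rw [h₁, incl_last, incl_last, coeffMap_tmul, coeffMap_tmul, move_outer]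

theorem algHom_ext {m : ℕ} {C : Type} [Semiring C] [Algebra k C] {F G : Obj k A B D m →ₐ[k] C}
    (ho : ∀ a b, F (a ⊗ₜ (1 ⊗ₜ b)) = G (a ⊗ₜ (1 ⊗ₜ b)))
    (hm : ∀ (j : Fin (2 * m + 1)) (x : B),
      F (1 ⊗ₜ (single k B m j x ⊗ₜ 1)) = G (1 ⊗ₜ (single k B m j x ⊗ₜ 1))) :
    F = G := by
  apply Algebra.TensorProduct.ext
  · ext a
    exact ho a 1
  · apply Algebra.TensorProduct.ext
    · exact mid_algHom_ext hm
    · ext b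
      exact ho 1 _

theorem move_move (l m n : ℕ) (f g : ℕ → ℕ) (g₀ : g 0 = 0)
    (g₁ : g (2 * m + 2) = 2 * n + 2) (hf : ∀ p ≤ 2 * l + 2, f p ≤ 2 * m + 2)
    (z : Obj k A B D l) :
    move ε η hε hη m n g (move ε η hε hη l m f z) = move ε η hε hη l n (g ∘ f) z := by
  suffices H : (move ε η hε hη m n g).comp (move ε η hε hη l m f) =
    move ε η hε hη l n (g ∘ f) from DFunLike.congr_fun H z
  refine algHom_ext (fun a b => ?_) fun j x => ?_
  · rw [AlgHom.comp_apply, move_outer, move_outer, move_outer]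
  · rw [AlgHom.comp_apply, move_single, move_single,
      move_coeffMap_incl _ _ _ _ _ _ _ g₀ g₁ _ (hf _ (by omega)), Function.comp_apply]

theorem move_congr (m n : ℕ) (f g : ℕ → ℕ) (h : ∀ p ≤ 2 * m + 2, f p = g p)
    (z : Obj k A B D m) : move ε η hε hη m n f z = move ε η hε hη m n g z := by
  suffices H : move ε η hε hη m n f = move ε η hε hη m n g from DFunLike.congr_fun H z
  refine algHom_ext (fun a b => ?_) fun j x => ?_
  · rw [move_outer, move_outer]
  · rw [move_single, move_single, h _ (by omega)]

theorem move_id (n : ℕ) (f : ℕ → ℕ) (hf : ∀ p ≤ 2 * n + 2, f p = p) (z : Obj k A B D n) :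
    move ε η hε hη n n f z = z := by
  suffices H : move ε η hε hη n n f = AlgHom.id k _ from DFunLike.congr_fun H z
  refine algHom_ext (fun a b => ?_) fun j x => ?_
  · rw [move_outer, AlgHom.id_apply]
  · rw [move_single, hf _ (by omega), incl_succ, coeffMap_tmul, map_one, map_one,
      AlgHom.id_apply]

/-- Where the `i`-th face into degree `n` moves the positions. -/
def facePos (n i p : ℕ) : ℕ := if p ≤ i then p else if p ≤ n + 2 + i then p - 1 else p - 2

/-- Where the `i`-th degeneracy from degree `n` moves the positions. -/
def degenPos (n i p : ℕ) : ℕ := if p ≤ i then p else if p ≤ n + 1 + i then p + 1 else p + 2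

/-- The simplicial algebra `𝒜(A,B,ε)`. -/
def simplicialAlgebra : SimplicialAlgebra k (Obj k A B D) where
  δ n i := move ε η hε hη (n + 1) n (facePos n (min i (n + 1)))
  σ n i := move ε η hε hη n (n + 1) (degenPos n (min i n))
  δδ n i j hij hj z := by
    rw [move_move, move_move]
    · apply move_congr
      grind [facePos, degenPos]
    all_goals grind [facePos, degenPos]
  σσ n i j hij hj z := by
    rw [move_move, move_move]
    · apply move_congr
      grind [facePos, degenPos]
    all_goals grind [facePos, degenPos]
  δσ_lt n i j hij hj z := by
    rw [move_move, move_move]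
    · apply move_congr
      grind [facePos, degenPos]
    all_goals grind [facePos, degenPos]
  δσ_eq n i j hij hj z := by
    rw [move_move, move_id]
    all_goals grind [facePos, degenPos]
  δσ_gt n i j hij hj z := by
    rw [move_move, move_move]
    · apply move_congr
      grind [facePos, degenPos]
    all_goals grind [facePos, degenPos]

theorem prod_filter_of_forall_not {N : ℕ} (P : Fin N → Prop) [DecidablePred P] (v : Fin N → B)
    (h : ∀ j, ¬ P j) : ∏ j with P j, v j = 1 := by
  rw [Finset.filter_false_of_mem fun j _ => h j, Finset.prod_empty]

theorem prod_filter_of_iff_eq {N : ℕ} (P : Fin N → Prop) [DecidablePred P] (v : Fin N → B)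
    (x : Fin N) (h : ∀ j, P j ↔ j.val = x.val) : ∏ j with P j, v j = v x := by
  have : Finset.univ.filter P = {x} := by
    ext j
    simp [h, Fin.ext_iff]
  rw [this, Finset.prod_singleton]

theorem prod_filter_of_iff_or {N : ℕ} (P : Fin N → Prop) [DecidablePred P] (v : Fin N → B)
    (x y : Fin N) (hxy : x.val ≠ y.val) (h : ∀ j, P j ↔ j.val = x.val ∨ j.val = y.val) :
    ∏ j with P j, v j = v x * v y := by
  have : Finset.univ.filter P = {x, y} := by
    ext j
    simp [h, Fin.ext_iff]
  rw [this, Finset.prod_pair fun e => hxy (congrArg Fin.val e)]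

theorem face_zero_apply (n : ℕ) (a : A) (b : D) (v : Fin (2 * n + 3) → B) :
    (simplicialAlgebra ε η hε hη).δ n 0 (a ⊗ₜ (pureTensor k B (n + 1) v ⊗ₜ b)) =
      (a * ε (v 0)) ⊗ₜ (pureTensor k B n (secFace0 n v) ⊗ₜ b) := by
  refine (move_pure ε η hε hη (n + 1) n (facePos n (min 0 (n + 1))) ?_ a b v (v 0) 1 (secFace0 n v) ?_ ?_ ?_).trans
    (by rw [map_one, mul_one])
  · grind [facePos]
  · refine prod_filter_of_iff_eq _ _ _ ?_
    grind [facePos]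
  · intro i
    unfold secFace0
    split_ifs
    · refine prod_filter_of_iff_eq _ _ _ ?_
      grind [facePos]
    · refine prod_filter_of_iff_or _ _ _ _ ?_ ?_ <;> grind [facePos]
    · refine prod_filter_of_iff_eq _ _ _ ?_
      grind [facePos]
  · refine prod_filter_of_forall_not _ _ ?_
    grind [facePos]

theorem face_mid_apply (n i : ℕ) (h₁ : 1 ≤ i) (hi : i ≤ n) (a : A) (b : D)
    (v : Fin (2 * n + 3) → B) :
    (simplicialAlgebra ε η hε hη).δ n i (a ⊗ₜ (pureTensor k B (n + 1) v ⊗ₜ b)) =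
      a ⊗ₜ (pureTensor k B n (secFaceMid n i v) ⊗ₜ b) := by
  refine (move_pure ε η hε hη (n + 1) n (facePos n (min i (n + 1))) ?_ a b v 1 1 (secFaceMid n i v) ?_ ?_ ?_).trans
    (by rw [map_one, map_one, mul_one, mul_one])
  · grind [facePos]
  · refine prod_filter_of_forall_not _ _ ?_
    grind [facePos]
  · intro i
    unfold secFaceMid
    split_ifs
    · refine prod_filter_of_iff_eq _ _ _ ?_
      grind [facePos]
    · refine prod_filter_of_iff_or _ _ _ _ ?_ ?_ <;> grind [facePos]
    · refine prod_filter_of_iff_eq _ _ _ ?_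
      grind [facePos]
    · refine prod_filter_of_iff_or _ _ _ _ ?_ ?_ <;> grind [facePos]
    · refine prod_filter_of_iff_eq _ _ _ ?_
      grind [facePos]
  · refine prod_filter_of_forall_not _ _ ?_
    grind [facePos]

theorem face_last_apply (n : ℕ) (a : A) (b : D) (v : Fin (2 * n + 3) → B) :
    (simplicialAlgebra ε η hε hη).δ n (n + 1) (a ⊗ₜ (pureTensor k B (n + 1) v ⊗ₜ b)) =
      a ⊗ₜ (pureTensor k B n (secFaceLast n v) ⊗ₜ (b * η (v (Fin.last _)))) := by
  refine (move_pure ε η hε hη (n + 1) n (facePos n (min (n + 1) (n + 1))) ?_ a b v 1 (v (Fin.last _)) (secFaceLast n v)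
    ?_ ?_ ?_).trans (by rw [map_one, mul_one])
  · grind [facePos]
  · refine prod_filter_of_forall_not _ _ ?_
    grind [facePos]
  · intro i
    unfold secFaceLast
    split_ifs
    · refine prod_filter_of_iff_eq _ _ _ ?_
      grind [facePos]
    · refine prod_filter_of_iff_or _ _ _ _ ?_ ?_ <;> grind [facePos]
    · refine prod_filter_of_iff_eq _ _ _ ?_
      grind [facePos]
  · refine prod_filter_of_iff_eq _ _ _ ?_
    grind [facePos]

theorem degen_apply (n i : ℕ) (hi : i ≤ n) (a : A) (b : D) (v : Fin (2 * n + 1) → B) :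
    (simplicialAlgebra ε η hε hη).σ n i (a ⊗ₜ (pureTensor k B n v ⊗ₜ b)) =
      a ⊗ₜ (pureTensor k B (n + 1) (secDegen n i hi v) ⊗ₜ b) := by
  refine (move_pure ε η hε hη n (n + 1) (degenPos n (min i n)) ?_ a b v 1 1 (secDegen n i hi v) ?_ ?_ ?_).trans
    (by rw [map_one, map_one, mul_one, mul_one])
  · grind [degenPos]
  · refine prod_filter_of_forall_not _ _ ?_
    grind [degenPos]
  · intro i
    unfold secDegen
    split_ifs
    · refine prod_filter_of_iff_eq _ _ _ ?_
      grind [degenPos]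
    · refine prod_filter_of_forall_not _ _ ?_
      grind [degenPos]
    · refine prod_filter_of_iff_eq _ _ _ ?_
      grind [degenPos]
    · refine prod_filter_of_forall_not _ _ ?_
      grind [degenPos]
    · refine prod_filter_of_iff_eq _ _ _ ?_
      grind [degenPos]
  · refine prod_filter_of_forall_not _ _ ?_
    grind [degenPos]

end SecondaryHochschild

end

/-- Let `A` be a `k`-algebra, `B` a commutative `k`-algebra and `ε : B → A` a morphism
of `k`-algebras with central image.  Then the data `𝒜ₙ = A ⊗ B^{⊗(2n+1)} ⊗ Aᵒᵖ`, with
the face maps `δᵢ` and degeneracy maps `σᵢ` of the secondary Hochschild setting, is a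
simplicial `k`-algebra `𝒜(A,B,ε)`: all the structure maps are morphisms of
`k`-algebras and they satisfy the simplicial identities. -/
theorem secondary_isSimplicialAlgebra (k A B : Type) [Field k] [Ring A] [Algebra k A]
    [CommRing B] [Algebra k B] (ε : B →ₐ[k] A)
    (hε : ∀ (β : B) (x : A), ε β * x = x * ε β) :
    ∃ str : SimplicialAlgebra k
        (fun n => A ⊗[k] ((⨂[k] (_ : Fin (2 * n + 1)), B) ⊗[k] Aᵐᵒᵖ)),
      (∀ n (a b : A) (v : Fin (2 * n + 3) → B),
        str.δ n 0 (a ⊗ₜ[k] ((tprod k v) ⊗ₜ[k] op b)) =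
          (a * ε (v ⟨0, by omega⟩)) ⊗ₜ[k] ((tprod k (secFace0 n v)) ⊗ₜ[k] op b)) ∧
      (∀ n i, 1 ≤ i → i ≤ n → ∀ (a b : A) (v : Fin (2 * n + 3) → B),
        str.δ n i (a ⊗ₜ[k] ((tprod k v) ⊗ₜ[k] op b)) =
          a ⊗ₜ[k] ((tprod k (secFaceMid n i v)) ⊗ₜ[k] op b)) ∧
      (∀ n (a b : A) (v : Fin (2 * n + 3) → B),
        str.δ n (n + 1) (a ⊗ₜ[k] ((tprod k v) ⊗ₜ[k] op b)) =
          a ⊗ₜ[k] ((tprod k (secFaceLast n v)) ⊗ₜ[k]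
            op (ε (v ⟨2 * n + 2, by omega⟩) * b))) ∧
      (∀ n i (hi : i ≤ n) (a b : A) (v : Fin (2 * n + 1) → B),
        str.σ n i (a ⊗ₜ[k] ((tprod k v) ⊗ₜ[k] op b)) =
          a ⊗ₜ[k] ((tprod k (secDegen n i hi v)) ⊗ₜ[k] op b)) := by
  let η : B →ₐ[k] Aᵐᵒᵖ := ε.toOpposite fun x _ => hε x _
  have hη : ∀ (β : B) (x : Aᵐᵒᵖ), η β * x = x * η β :=
    fun β x => unop_injective (hε β x.unop).symm
  exact ⟨SecondaryHochschild.simplicialAlgebra ε η hε hη,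
    fun n a b v => SecondaryHochschild.face_zero_apply ε η hε hη n a (op b) v,
    fun n i h₁ hi a b v => SecondaryHochschild.face_mid_apply ε η hε hη n i h₁ hi a (op b) v,
    fun n a b v => SecondaryHochschild.face_last_apply ε η hε hη n a (op b) v,
    fun n i hi a b v => SecondaryHochschild.degen_apply ε η hε hη n i hi a (op b) v⟩
end

section
/- Let 𝕜 be a field, A a unital associative 𝕜-algebra, B a commutative unital 𝕜-algebra, ε : B → A a morphism of 𝕜-algebras with ε(B) ⊆ 𝒵(A), and M an A-bimodule that is B-symmetric (i.e., ε(β)m = mε(β) for all β ∈ B, m ∈ M). Setting 𝒮_n = M for all n ≥ 0 with the right 𝒜_n-module structure m·(a⊗α_1⊗⋯⊗α_n⊗γ⊗β_1⊗⋯⊗β_n⊗b) = b m a ε(α_1⋯α_nγβ_1⋯β_n) over 𝒜_n = A ⊗ B^{⊗2n+1} ⊗ A^{op}, and with δ_i^𝒮 = id_M and σ_i^𝒮 = id_M for all 0 ≤ i ≤ n, the data 𝒮(M) is a simplicial right module over the simplicial 𝕜-algebra 𝒜(A,B,ε): each 𝒮_n is a right 𝒜_n-module under the stated action, and the identity face and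 degeneracy maps satisfy the compatibility conditions δ_i^𝒮(m·a_n) = δ_i^𝒮(m)·δ_i^𝒜(a_n) and σ_i^𝒮(m·a_n) = σ_i^𝒮(m)·σ_i^𝒜(a_n) for all a_n ∈ 𝒜_n, m ∈ M. -/
open scoped TensorProduct
open MulOpposite PiTensorProduct

/-- A simplicial right module over a simplicial `k`-algebra `𝓐`; the right
`A n`-module structure on `M n` is encoded by the `k`-bilinear action map
`act n`, with `act n r` being right multiplication by `r`. -/
structure SimplicialRightModule (k : Type) [Field k] {A : ℕ → Type}
    [∀ n, Ring (A n)] [∀ n, Algebra k (A n)] (𝓐 : SimplicialAlgebra k A)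
    (M : ℕ → Type) [∀ n, AddCommGroup (M n)] [∀ n, Module k (M n)] where
  act : ∀ n, A n →ₗ[k] M n →ₗ[k] M n
  act_one : ∀ n (m : M n), act n 1 m = m
  act_mul : ∀ n (r s : A n) (m : M n), act n (r * s) m = act n s (act n r m)
  δ : (n : ℕ) → ℕ → (M (n + 1) →ₗ[k] M n)
  σ : (n : ℕ) → ℕ → (M n →ₗ[k] M (n + 1))
  δδ : ∀ n i j, i < j → j ≤ n + 2 → ∀ m, δ n i (δ (n + 1) j m) = δ n (j - 1) (δ (n + 1) i m)
  σσ : ∀ n i j, i ≤ j → j ≤ n → ∀ m, σ (n + 1) i (σ n j m) = σ (n + 1) (j + 1) (σ n i m)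
  δσ_lt : ∀ n i j, i < j → j ≤ n + 1 → ∀ m, δ (n + 1) i (σ (n + 1) j m) = σ n (j - 1) (δ n i m)
  δσ_eq : ∀ n i j, (i = j ∨ i = j + 1) → j ≤ n → ∀ m, δ n i (σ n j m) = m
  δσ_gt : ∀ n i j, j + 1 < i → i ≤ n + 2 → ∀ m, δ (n + 1) i (σ (n + 1) j m) = σ n j (δ n (i - 1) m)
  δ_act : ∀ n i, i ≤ n + 1 → ∀ (r : A (n + 1)) (m : M (n + 1)),
    δ n i (act (n + 1) r m) = act n (𝓐.δ n i r) (δ n i m)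
  σ_act : ∀ n i, i ≤ n → ∀ (r : A n) (m : M n),
    σ n i (act n r m) = act (n + 1) (𝓐.σ n i r) (σ n i m)


section Products

variable {B : Type} [CommRing B]

theorem prod_range_merge {N p : ℕ} (hp : p < N) (w : ℕ → B) :
    ∏ m ∈ Finset.range N, (if m < p then w m else if m = p then w m * w (m + 1) else w (m + 1)) =
      ∏ m ∈ Finset.range (N + 1), w m := by
  induction N, hp using Nat.le_induction with
  | base =>
    rw [Finset.prod_range_succ, Finset.prod_range_succ, Finset.prod_range_succ _ p,
      Finset.prod_congr rfl fun m hm => if_pos (Finset.mem_range.mp hm)]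
    simp [mul_assoc]
  | succ N hN ih =>
    rw [Finset.prod_range_succ, ih, Finset.prod_range_succ _ (N + 1), if_neg (by omega),
      if_neg (by omega)]

theorem prod_range_insert_one {N p : ℕ} (hp : p ≤ N) (w : ℕ → B) :
    ∏ m ∈ Finset.range (N + 1), (if m < p then w m else if m = p then 1 else w (m - 1)) =
      ∏ m ∈ Finset.range N, w m := by
  induction N, hp using Nat.le_induction with
  | base =>
    rw [Finset.prod_range_succ,
      Finset.prod_congr rfl fun m hm => if_pos (Finset.mem_range.mp hm)]
    simp
  | succ N hN ih =>
    rw [Finset.prod_range_succ, ih, Finset.prod_range_succ _ N, if_neg (by omega),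
      if_neg (by omega), Nat.add_sub_cancel]

theorem exists_nat_extension {N : ℕ} (v : Fin N → B) :
    ∃ w : ℕ → B, v = fun j : Fin N => w (j : ℕ) :=
  ⟨fun m => if h : m < N then v ⟨m, h⟩ else 1, by ext j; simp⟩

theorem prod_secFace0 (n : ℕ) (v : Fin (2 * n + 3) → B) (h₀ : 0 < 2 * n + 3) :
    v ⟨0, h₀⟩ * ∏ j, secFace0 n v j = ∏ j, v j := by
  obtain ⟨w, rfl⟩ := exists_nat_extension v
  have h := prod_range_merge (show n < 2 * n + 1 by omega) (fun m => w (m + 1))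
  rw [Fin.prod_univ_eq_prod_range w, Finset.prod_range_succ', ← h, mul_comm,
    ← Fin.prod_univ_eq_prod_range]
  refine congrArg (· * w 0) (Finset.prod_congr rfl fun j _ => ?_)
  unfold secFace0
  split_ifs with h₁ h₂
  · rfl
  · simp only [h₂]
  · rfl

theorem prod_secFaceMid {n i : ℕ} (hi : 1 ≤ i) (hin : i ≤ n) (v : Fin (2 * n + 3) → B) :
    ∏ j, secFaceMid n i v j = ∏ j, v j := by
  obtain ⟨w, rfl⟩ := exists_nat_extension v
  rw [Fin.prod_univ_eq_prod_range w, ← prod_range_merge (show n + i + 1 < 2 * n + 2 by omega),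
    ← prod_range_merge (show i - 1 < 2 * n + 1 by omega), ← Fin.prod_univ_eq_prod_range]
  refine Finset.prod_congr rfl fun j _ => ?_
  unfold secFaceMid
  grind

theorem prod_secFaceLast (n : ℕ) (v : Fin (2 * n + 3) → B) (hn : 2 * n + 2 < 2 * n + 3) :
    (∏ j, secFaceLast n v j) * v ⟨2 * n + 2, hn⟩ = ∏ j, v j := by
  obtain ⟨w, rfl⟩ := exists_nat_extension v
  rw [Fin.prod_univ_eq_prod_range w, Finset.prod_range_succ,
    ← prod_range_merge (show n < 2 * n + 1 by omega), ← Fin.prod_univ_eq_prod_range]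
  refine congrArg (· * w (2 * n + 2)) (Finset.prod_congr rfl fun j _ => ?_)
  unfold secFaceLast
  split_ifs with h₁ h₂
  · rfl
  · simp only [h₂]
  · rfl

theorem prod_secDegen {n i : ℕ} (hi : i ≤ n) (v : Fin (2 * n + 1) → B) :
    ∏ j, secDegen n i hi v j = ∏ j, v j := by
  obtain ⟨w, rfl⟩ := exists_nat_extension v
  rw [Fin.prod_univ_eq_prod_range w, ← prod_range_insert_one (show i ≤ 2 * n + 1 by omega),
    ← prod_range_insert_one (show n + 2 + i ≤ 2 * n + 1 + 1 by omega),
    ← Fin.prod_univ_eq_prod_range]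
  refine Finset.prod_congr rfl fun j _ => ?_
  unfold secDegen
  grind

end Products

section Action

variable {k A B M : Type} [Field k] [Ring A] [Algebra k A] [CommRing B] [Algebra k B]

theorem tensor_linearMap_ext {N : ℕ} {P : Type} [AddCommGroup P] [Module k P]
    {f g : (A ⊗[k] ((⨂[k] (_ : Fin N), B) ⊗[k] Aᵐᵒᵖ)) →ₗ[k] P}
    (h : ∀ (a b : A) (v : Fin N → B), f (a ⊗ₜ[k] ((tprod k v) ⊗ₜ[k] op b)) =
      g (a ⊗ₜ[k] ((tprod k v) ⊗ₜ[k] op b))) : f = g := by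
  refine TensorProduct.ext (LinearMap.ext fun a => TensorProduct.ext
    (PiTensorProduct.ext (MultilinearMap.ext fun v => LinearMap.ext fun b => ?_)))
  exact h a b.unop v

/-- Three algebra homomorphisms with pairwise commuting images induce an algebra homomorphism
from the triple tensor product. -/
noncomputable def tripleLift {R S T E : Type} [Ring R] [Algebra k R] [Ring S] [Algebra k S]
    [Ring T] [Algebra k T] [Ring E] [Algebra k E] (f : R →ₐ[k] E) (g : S →ₐ[k] E) (h : T →ₐ[k] E)
    (hfg : ∀ x y, Commute (f x) (g y)) (hfh : ∀ x y, Commute (f x) (h y))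
    (hgh : ∀ x y, Commute (g x) (h y)) : R ⊗[k] (S ⊗[k] T) →ₐ[k] E :=
  Algebra.TensorProduct.lift f (Algebra.TensorProduct.lift g h hgh) fun a t => by
    induction t using TensorProduct.induction_on with
    | zero => rw [map_zero]; exact Commute.zero_right _
    | add s t hs ht => rw [map_add]; exact hs.add_right ht
    | tmul x b =>
      rw [Algebra.TensorProduct.lift_tmul]
      exact (hfg a x).mul_right (hfh a b)

theorem tripleLift_tmul {R S T E : Type} [Ring R] [Algebra k R] [Ring S] [Algebra k S]
    [Ring T] [Algebra k T] [Ring E] [Algebra k E] (f : R →ₐ[k] E) (g : S →ₐ[k] E) (h : T →ₐ[k] E)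
    (hfg : ∀ x y, Commute (f x) (g y)) (hfh : ∀ x y, Commute (f x) (h y))
    (hgh : ∀ x y, Commute (g x) (h y)) (x : R) (y : S) (z : T) :
    tripleLift f g h hfg hfh hgh (x ⊗ₜ[k] (y ⊗ₜ[k] z)) = f x * (g y * h z) := by
  rw [tripleLift, Algebra.TensorProduct.lift_tmul, Algebra.TensorProduct.lift_tmul]

variable [AddCommGroup M] [Module k M] [Module Aᵐᵒᵖ M] [IsScalarTower k Aᵐᵒᵖ M]

variable (k A M) in
/-- Right multiplication by elements of `A` on `M`. -/
def rightMulHom : A →ₐ[k] (Module.End k M)ᵐᵒᵖ :=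
  AlgHom.opComm.symm (Algebra.lsmul k k M)

/-- The map `β₁ ⊗ ⋯ ⊗ β_N ↦ ε(β₁⋯β_N)`. -/
noncomputable def piMulHom (ε : B →ₐ[k] A) (N : ℕ) : (⨂[k] (_ : Fin N), B) →ₐ[k] A :=
  ε.comp (PiTensorProduct.liftAlgHom (MultilinearMap.mkPiAlgebra k (Fin N) B) (by simp)
    (fun x y => by simp [Finset.prod_mul_distrib]))

theorem piMulHom_tprod (ε : B →ₐ[k] A) (N : ℕ) (v : Fin N → B) :
    piMulHom ε N (tprod k v) = ε (∏ j, v j) :=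
  congrArg ε ((PiTensorProduct.lift.tprod v).trans (MultilinearMap.mkPiAlgebra_apply ..))

theorem commute_rightMulHom_piMulHom (ε : B →ₐ[k] A)
    (hε : ∀ (β : B) (x : A), ε β * x = x * ε β) (N : ℕ) (a : A) (x : ⨂[k] (_ : Fin N), B) :
    Commute (rightMulHom k A M a) ((rightMulHom k A M).comp (piMulHom ε N) x) :=
  Commute.map (show Commute a (piMulHom ε N x) from (hε _ a).symm) (rightMulHom k A M)

variable [Module A M] [IsScalarTower k A M] [SMulCommClass A Aᵐᵒᵖ M]

variable (k A M) in
/-- Left multiplication by elements of `A` on `M`. -/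
def leftMulHom : Aᵐᵒᵖ →ₐ[k] (Module.End k M)ᵐᵒᵖ :=
  AlgHom.op (Algebra.lsmul k k M)

theorem commute_rightMulHom_leftMulHom (a : A) (b : Aᵐᵒᵖ) :
    Commute (rightMulHom k A M a) (leftMulHom k A M b) :=
  unop_injective (LinearMap.ext fun m => smul_comm b.unop (op a) m)

/-- The `A`-bimodule `M` as a right module over `A ⊗ B^{⊗N} ⊗ Aᵒᵖ`, in the form of an algebra
homomorphism to the opposite of its endomorphism algebra. -/
noncomputable def bimoduleAction (ε : B →ₐ[k] A) (hε : ∀ (β : B) (x : A), ε β * x = x * ε β)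
    (N : ℕ) :
    (A ⊗[k] ((⨂[k] (_ : Fin N), B) ⊗[k] Aᵐᵒᵖ)) →ₐ[k] (Module.End k M)ᵐᵒᵖ :=
  tripleLift (rightMulHom k A M) ((rightMulHom k A M).comp (piMulHom ε N)) (leftMulHom k A M)
    (commute_rightMulHom_piMulHom ε hε N) commute_rightMulHom_leftMulHom
    (fun x b => commute_rightMulHom_leftMulHom (piMulHom ε N x) b)

theorem bimoduleAction_tmul (ε : B →ₐ[k] A) (hε : ∀ (β : B) (x : A), ε β * x = x * ε β)
    (N : ℕ) (a b : A) (v : Fin N → B) (m : M) :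
    (bimoduleAction (M := M) ε hε N (a ⊗ₜ[k] ((tprod k v) ⊗ₜ[k] op b))).unop m =
      b • (op (a * ε (∏ j, v j)) • m) := by
  have h := congrArg (fun f : (Module.End k M)ᵐᵒᵖ => f.unop m)
    (tripleLift_tmul (rightMulHom k A M) ((rightMulHom k A M).comp (piMulHom ε N))
      (leftMulHom k A M) (commute_rightMulHom_piMulHom ε hε N) commute_rightMulHom_leftMulHom
      (fun x b => commute_rightMulHom_leftMulHom (piMulHom ε N x) b) a (tprod k v) (op b))
  refine h.trans ?_
  rw [AlgHom.comp_apply, piMulHom_tprod, op_mul, mul_smul]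
  rfl

end Action

/-- Let `ε : B → A` have central image and let `M` be an `A`-bimodule which is
`B`-symmetric.  Then `𝒮ₙ = M`, with the right `𝒜ₙ = A ⊗ B^{⊗(2n+1)} ⊗ Aᵒᵖ`-action
`m · (a ⊗ α₁ ⊗ ⋯ ⊗ βₙ ⊗ b) = b·m·a·ε(α₁⋯αₙγβ₁⋯βₙ)` and identity face and degeneracy
maps, is a simplicial right module `𝒮(M)` over the simplicial `k`-algebra
`𝒜(A,B,ε)` (here given by `str` together with its defining formulas on pure
tensors). -/
theorem secondary_coefficients_isSimplicialRightModule (k A B M : Type) [Field k]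
    [Ring A] [Algebra k A] [CommRing B] [Algebra k B] (ε : B →ₐ[k] A)
    (hε : ∀ (β : B) (x : A), ε β * x = x * ε β)
    [AddCommGroup M] [Module k M] [Module A M] [Module Aᵐᵒᵖ M]
    [IsScalarTower k A M] [IsScalarTower k Aᵐᵒᵖ M] [SMulCommClass A Aᵐᵒᵖ M]
    (hsym : ∀ (β : B) (m : M), ε β • m = op (ε β) • m)
    (str : SimplicialAlgebra k
      (fun n => A ⊗[k] ((⨂[k] (_ : Fin (2 * n + 1)), B) ⊗[k] Aᵐᵒᵖ)))
    (hδ0 : ∀ n (a b : A) (v : Fin (2 * n + 3) → B),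
      str.δ n 0 (a ⊗ₜ[k] ((tprod k v) ⊗ₜ[k] op b)) =
        (a * ε (v ⟨0, by omega⟩)) ⊗ₜ[k] ((tprod k (secFace0 n v)) ⊗ₜ[k] op b))
    (hδmid : ∀ n i, 1 ≤ i → i ≤ n → ∀ (a b : A) (v : Fin (2 * n + 3) → B),
      str.δ n i (a ⊗ₜ[k] ((tprod k v) ⊗ₜ[k] op b)) =
        a ⊗ₜ[k] ((tprod k (secFaceMid n i v)) ⊗ₜ[k] op b))
    (hδlast : ∀ n (a b : A) (v : Fin (2 * n + 3) → B),
      str.δ n (n + 1) (a ⊗ₜ[k] ((tprod k v) ⊗ₜ[k] op b)) =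
        a ⊗ₜ[k] ((tprod k (secFaceLast n v)) ⊗ₜ[k]
          op (ε (v ⟨2 * n + 2, by omega⟩) * b)))
    (hσ : ∀ n i (hi : i ≤ n) (a b : A) (v : Fin (2 * n + 1) → B),
      str.σ n i (a ⊗ₜ[k] ((tprod k v) ⊗ₜ[k] op b)) =
        a ⊗ₜ[k] ((tprod k (secDegen n i hi v)) ⊗ₜ[k] op b)) :
    ∃ 𝒮 : SimplicialRightModule k str (fun _ => M),
      (∀ n (a b : A) (v : Fin (2 * n + 1) → B) (m : M),
        𝒮.act n (a ⊗ₜ[k] ((tprod k v) ⊗ₜ[k] op b)) m =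
          b • (op (a * ε (∏ j, v j)) • m)) ∧
      (∀ n i, i ≤ n + 1 → ∀ m, 𝒮.δ n i m = m) ∧
      (∀ n i, i ≤ n → ∀ m, 𝒮.σ n i m = m) := by
  let act (n : ℕ) : (A ⊗[k] ((⨂[k] (_ : Fin (2 * n + 1)), B) ⊗[k] Aᵐᵒᵖ)) →ₗ[k] M →ₗ[k] M :=
    (opLinearEquiv k).symm.toLinearMap ∘ₗ (bimoduleAction ε hε (2 * n + 1)).toLinearMap
  have act_tmul (n : ℕ) (a b : A) (v : Fin (2 * n + 1) → B) (m : M) :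
      act n (a ⊗ₜ[k] ((tprod k v) ⊗ₜ[k] op b)) m = b • (op (a * ε (∏ j, v j)) • m) :=
    bimoduleAction_tmul ε hε _ a b v m
  have act_face (n i : ℕ) (hi : i ≤ n + 1) : act (n + 1) = act n ∘ₗ (str.δ n i).toLinearMap := by
    refine tensor_linearMap_ext fun a b v => LinearMap.ext fun m => ?_
    rw [act_tmul (n + 1), LinearMap.comp_apply, AlgHom.toLinearMap_apply]
    obtain rfl | h0 := Nat.eq_zero_or_pos i
    · rw [hδ0, act_tmul, mul_assoc, ← map_mul, prod_secFace0]
      rfl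
    obtain rfl | h1 := hi.eq_or_lt
    · rw [hδlast, act_tmul, hε, mul_smul b, hsym, ← mul_smul (op _) (op _), ← op_mul, mul_assoc,
        ← map_mul, prod_secFaceLast]
      rfl
    · rw [hδmid n i h0 (by omega), act_tmul, prod_secFaceMid h0 (by omega)]
      rfl
  have act_degen (n i : ℕ) (hi : i ≤ n) : act n = act (n + 1) ∘ₗ (str.σ n i).toLinearMap := by
    refine tensor_linearMap_ext fun a b v => LinearMap.ext fun m => ?_
    rw [act_tmul, LinearMap.comp_apply, AlgHom.toLinearMap_apply, hσ n i hi, act_tmul (n + 1)]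
    exact congrArg (fun x => b • (op (a * ε x) • m)) (prod_secDegen hi v).symm
  refine ⟨{
    act := act
    act_one := fun n m => ?_
    act_mul := fun n r s m => ?_
    δ := fun _ _ => LinearMap.id
    σ := fun _ _ => LinearMap.id
    δδ := fun _ _ _ _ _ _ => rfl
    σσ := fun _ _ _ _ _ _ => rfl
    δσ_lt := fun _ _ _ _ _ _ => rfl
    δσ_eq := fun _ _ _ _ _ _ => rfl
    δσ_gt := fun _ _ _ _ _ _ => rfl
    δ_act := fun n i hi r m => congrArg (fun f => f r m) (act_face n i hi)
    σ_act := fun n i hi r m => congrArg (fun f => f r m) (act_degen n i hi) },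
    act_tmul, fun _ _ _ _ => rfl, fun _ _ _ _ => rfl⟩
  · exact congrArg (fun f => f.unop m) (bimoduleAction (M := M) ε hε (2 * n + 1)).map_one'
  · exact congrArg (fun f => f.unop m) ((bimoduleAction (M := M) ε hε (2 * n + 1)).map_mul' r s)
end

section
/- Let 𝕜 be a field, A a unital associative 𝕜-algebra, and M an A-bimodule. If 𝒞 is a simplicial left module over the constant simplicial 𝕜-algebra 𝒜(A⊗A^{op}) and there exists a presimplicial homotopy equivalence f : ℬ(A) → 𝒞 (where ℬ(A) is the bar resolution viewed as a simplicial left module over 𝒜(A⊗A^{op})), then the Hochschild homology of A with coefficients in M is isomorphic to the homology of the chain complex ℳ(M) ⊗_{𝒜(A⊗A^{op})} 𝒞: H_•(A,M) ≅ H_•(ℳ(M) ⊗_{𝒜(A⊗A^{op})} 𝒞). -/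
open scoped TensorProduct
open MulOpposite PiTensorProduct

/-- A simplicial left module over a simplicial `k`-algebra `𝓐`.  The left
`A n`-module structure on `B n` (extending the `k`-vector space structure) is
encoded by the `k`-bilinear action map `act n` which is unital and multiplicative. -/
structure SimplicialLeftModule (k : Type) [Field k] {A : ℕ → Type}
    [∀ n, Ring (A n)] [∀ n, Algebra k (A n)] (𝓐 : SimplicialAlgebra k A)
    (B : ℕ → Type) [∀ n, AddCommGroup (B n)] [∀ n, Module k (B n)] where
  act : ∀ n, A n →ₗ[k] B n →ₗ[k] B n
  act_one : ∀ n (b : B n), act n 1 b = b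
  act_mul : ∀ n (r s : A n) (b : B n), act n (r * s) b = act n r (act n s b)
  δ : (n : ℕ) → ℕ → (B (n + 1) →ₗ[k] B n)
  σ : (n : ℕ) → ℕ → (B n →ₗ[k] B (n + 1))
  δδ : ∀ n i j, i < j → j ≤ n + 2 → ∀ b, δ n i (δ (n + 1) j b) = δ n (j - 1) (δ (n + 1) i b)
  σσ : ∀ n i j, i ≤ j → j ≤ n → ∀ b, σ (n + 1) i (σ n j b) = σ (n + 1) (j + 1) (σ n i b)
  δσ_lt : ∀ n i j, i < j → j ≤ n + 1 → ∀ b, δ (n + 1) i (σ (n + 1) j b) = σ n (j - 1) (δ n i b)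
  δσ_eq : ∀ n i j, (i = j ∨ i = j + 1) → j ≤ n → ∀ b, δ n i (σ n j b) = b
  δσ_gt : ∀ n i j, j + 1 < i → i ≤ n + 2 → ∀ b, δ (n + 1) i (σ (n + 1) j b) = σ n j (δ n (i - 1) b)
  δ_act : ∀ n i, i ≤ n + 1 → ∀ (r : A (n + 1)) (b : B (n + 1)),
    δ n i (act (n + 1) r b) = act n (𝓐.δ n i r) (δ n i b)
  σ_act : ∀ n i, i ≤ n → ∀ (r : A n) (b : B n),
    σ n i (act n r b) = act (n + 1) (𝓐.σ n i r) (σ n i b)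

variable {k : Type} [Field k] {A : ℕ → Type} [∀ n, Ring (A n)] [∀ n, Algebra k (A n)]
  {𝓐 : SimplicialAlgebra k A}
  {M' B C D : ℕ → Type}
  [∀ n, AddCommGroup (M' n)] [∀ n, Module k (M' n)]
  [∀ n, AddCommGroup (B n)] [∀ n, Module k (B n)]
  [∀ n, AddCommGroup (C n)] [∀ n, Module k (C n)]
  [∀ n, AddCommGroup (D n)] [∀ n, Module k (D n)]

/-- A presimplicial morphism between simplicial left modules: a family of
`A n`-module morphisms commuting with the face maps. -/
structure PresimplicialMorphism (ℬ : SimplicialLeftModule k 𝓐 B)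
    (𝒞 : SimplicialLeftModule k 𝓐 C) where
  f : ∀ n, B n →ₗ[k] C n
  f_act : ∀ n (r : A n) (b : B n), f n (ℬ.act n r b) = 𝒞.act n r (f n b)
  comm : ∀ n i, i ≤ n + 1 → ∀ b, f n (ℬ.δ n i b) = 𝒞.δ n i (f (n + 1) b)

/-- `h` is a presimplicial homotopy between the presimplicial morphisms `φ` and `ψ`. -/
def IsPresimplicialHomotopy {ℬ : SimplicialLeftModule k 𝓐 B} {𝒞 : SimplicialLeftModule k 𝓐 C}
    (φ ψ : PresimplicialMorphism ℬ 𝒞)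
    (h : (n : ℕ) → ℕ → (B n →ₗ[k] C (n + 1))) : Prop :=
  (∀ n i, i ≤ n → ∀ (r : A n) (b : B n),
      h n i (ℬ.act n r b) = 𝒞.act (n + 1) (𝓐.σ n i r) (h n i b)) ∧
  (∀ n i j, i < j → j ≤ n + 1 → ∀ b, 𝒞.δ (n + 1) i (h (n + 1) j b) = h n (j - 1) (ℬ.δ n i b)) ∧
  (∀ n i, 0 < i → i ≤ n → ∀ b, 𝒞.δ n i (h n i b) = 𝒞.δ n i (h n (i - 1) b)) ∧
  (∀ n i j, j + 1 < i → i ≤ n + 2 → ∀ b, 𝒞.δ (n + 1) i (h (n + 1) j b) = h n j (ℬ.δ n (i - 1) b)) ∧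
  (∀ n b, 𝒞.δ n 0 (h n 0 b) = φ.f n b) ∧
  (∀ n b, 𝒞.δ n (n + 1) (h n n b) = ψ.f n b)

/-- Composition of presimplicial morphisms. -/
def PresimplicialMorphism.comp {ℬ : SimplicialLeftModule k 𝓐 B}
    {𝒞 : SimplicialLeftModule k 𝓐 C} {𝒟 : SimplicialLeftModule k 𝓐 D}
    (ψ : PresimplicialMorphism 𝒞 𝒟) (φ : PresimplicialMorphism ℬ 𝒞) :
    PresimplicialMorphism ℬ 𝒟 where
  f := fun n => (ψ.f n).comp (φ.f n)
  f_act := fun n r b => by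
    simp only [LinearMap.comp_apply, φ.f_act, ψ.f_act]
  comm := fun n i hi b => by
    simp only [LinearMap.comp_apply, φ.comm n i hi, ψ.comm n i hi]

/-- The identity presimplicial morphism. -/
def PresimplicialMorphism.id (ℬ : SimplicialLeftModule k 𝓐 B) :
    PresimplicialMorphism ℬ ℬ where
  f := fun _ => LinearMap.id
  f_act := fun _ _ _ => rfl
  comm := fun _ _ _ _ => rfl

/-- A presimplicial morphism `φ : ℬ → 𝒞` is a presimplicial homotopy equivalence if there
is a presimplicial morphism `ψ : 𝒞 → ℬ` with `ψ ∘ φ` presimplicially homotopic to `id ℬ`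
and `φ ∘ ψ` presimplicially homotopic to `id 𝒞`. -/
def IsPresimplicialHomotopyEquivalence {ℬ : SimplicialLeftModule k 𝓐 B}
    {𝒞 : SimplicialLeftModule k 𝓐 C} (φ : PresimplicialMorphism ℬ 𝒞) : Prop :=
  ∃ ψ : PresimplicialMorphism 𝒞 ℬ,
    (∃ h, IsPresimplicialHomotopy (ψ.comp φ) (PresimplicialMorphism.id ℬ) h) ∧
    (∃ t, IsPresimplicialHomotopy (φ.comp ψ) (PresimplicialMorphism.id 𝒞) t)

/-- The constant simplicial `k`-algebra on a `k`-algebra `R`, with identity face and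
degeneracy maps. -/
def constAlg (k : Type) [Field k] (R : Type) [Ring R] [Algebra k R] :
    SimplicialAlgebra k (fun _ => R) where
  δ := fun _ _ => AlgHom.id k R
  σ := fun _ _ => AlgHom.id k R
  δδ := fun _ _ _ _ _ _ => rfl
  σσ := fun _ _ _ _ _ _ => rfl
  δσ_lt := fun _ _ _ _ _ _ => rfl
  δσ_eq := fun _ _ _ _ _ _ => rfl
  δσ_gt := fun _ _ _ _ _ _ => rfl

/-- The `i`-th face map of the bar resolution on pure tensors: multiply the `i`-th and
`(i+1)`-st tensor factors. -/
def barFace {A : Type} [Ring A] (n i : ℕ) (v : Fin (n + 3) → A) : Fin (n + 2) → A :=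
  fun j =>
    if (j : ℕ) < i then v ⟨j, by omega⟩
    else if (j : ℕ) = i then v ⟨j, by omega⟩ * v ⟨(j : ℕ) + 1, by omega⟩
    else v ⟨(j : ℕ) + 1, by omega⟩

/-- The `i`-th degeneracy map of the bar resolution on pure tensors: insert a `1`
after the `i`-th tensor factor. -/
def barDegen {A : Type} [Ring A] (n i : ℕ) (hi : i ≤ n) (v : Fin (n + 2) → A) :
    Fin (n + 3) → A :=
  fun j =>
    if h : (j : ℕ) ≤ i then v ⟨j, by omega⟩
    else if (j : ℕ) = i + 1 then 1
    else v ⟨(j : ℕ) - 1, by omega⟩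

/-- The action of `a ⊗ bᵒᵖ ∈ A ⊗ Aᵒᵖ` on a pure tensor `a₀ ⊗ ⋯ ⊗ a_{n+1}` of the bar
resolution: `a·a₀ ⊗ a₁ ⊗ ⋯ ⊗ aₙ ⊗ a_{n+1}·b`. -/
def barAct {A : Type} [Ring A] (n : ℕ) (a b : A) (v : Fin (n + 2) → A) : Fin (n + 2) → A :=
  fun j => if (j : ℕ) = 0 then a * v j else if (j : ℕ) = n + 1 then v j * b else v j

/-- Merging the `i`-th and `(i+1)`-st entries (`1 ≤ i ≤ n`) of `a₁ ⊗ ⋯ ⊗ a_{n+1}` in the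
standard Hochschild complex. -/
def hochMerge {A : Type} [Ring A] (n i : ℕ) (v : Fin (n + 1) → A) : Fin n → A :=
  fun j =>
    if (j : ℕ) < i - 1 then v ⟨j, by omega⟩
    else if (j : ℕ) = i - 1 then v ⟨j, by omega⟩ * v ⟨(j : ℕ) + 1, by omega⟩
    else v ⟨(j : ℕ) + 1, by omega⟩

/-- The submodule of `M ⊗[k] C n` by which one quotients to obtain the balanced tensor
product `ℳ(M) n ⊗[A ⊗ Aᵒᵖ] 𝒞 n`, where `ℳ(M)` is the simplicial right module on `M`
with right action `m · (a ⊗ b) = b·m·a` and `𝒞` is a simplicial left module over the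
constant simplicial algebra on `A ⊗ Aᵒᵖ`. -/
def coeffRel (k A M : Type) [Field k] [Ring A] [Algebra k A] [AddCommGroup M]
    [Module k M] [Module A M] [Module Aᵐᵒᵖ M]
    {C : ℕ → Type} [∀ n, AddCommGroup (C n)] [∀ n, Module k (C n)]
    (𝒞 : SimplicialLeftModule k (constAlg k (A ⊗[k] Aᵐᵒᵖ)) C) (n : ℕ) :
    Submodule k (M ⊗[k] C n) :=
  Submodule.span k {z | ∃ (a b : A) (m : M) (c : C n),
    z = (b • (op a • m)) ⊗ₜ[k] c - m ⊗ₜ[k] (𝒞.act n (a ⊗ₜ[k] op b) c)}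

/-- The `n`-th term `M ⊗[A ⊗ Aᵒᵖ] C n` of the complex `ℳ(M) ⊗ 𝒞`. -/
abbrev CoeffTen (k A M : Type) [Field k] [Ring A] [Algebra k A] [AddCommGroup M]
    [Module k M] [Module A M] [Module Aᵐᵒᵖ M]
    {C : ℕ → Type} [∀ n, AddCommGroup (C n)] [∀ n, Module k (C n)]
    (𝒞 : SimplicialLeftModule k (constAlg k (A ⊗[k] Aᵐᵒᵖ)) C) (n : ℕ) :=
  (M ⊗[k] C n) ⧸ coeffRel k A M 𝒞 n

/-- The degree-`0` homology of a chain complex `⋯ → Y --d→ X → 0`. -/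
abbrev Homology0 {k : Type} [Field k] {X Y : Type} [AddCommGroup X] [Module k X]
    [AddCommGroup Y] [Module k Y] (d : Y →ₗ[k] X) : Type :=
  X ⧸ LinearMap.range d

/-- The homology in positive degrees: `ker d₁ / im d₂` for `Z --d₂→ Y --d₁→ X`. -/
abbrev HomologySucc {k : Type} [Field k] {X Y Z : Type} [AddCommGroup X] [Module k X]
    [AddCommGroup Y] [Module k Y] [AddCommGroup Z] [Module k Z]
    (d₁ : Y →ₗ[k] X) (d₂ : Z →ₗ[k] Y) : Type :=
  ↥(LinearMap.ker d₁) ⧸ (LinearMap.range d₂).comap (LinearMap.ker d₁).subtype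

/-- Two consecutive pairs of linear maps with mutually inverse (up to boundaries) morphisms
between them have isomorphic homology in positive degrees. -/
theorem nonempty_homologySucc_equiv {k : Type} [Field k] {X Y Z X' Y' Z' : Type}
    [AddCommGroup X] [Module k X] [AddCommGroup Y] [Module k Y] [AddCommGroup Z] [Module k Z]
    [AddCommGroup X'] [Module k X'] [AddCommGroup Y'] [Module k Y'] [AddCommGroup Z'] [Module k Z']
    {d₁ : Y →ₗ[k] X} {d₂ : Z →ₗ[k] Y} {d₁' : Y' →ₗ[k] X'} {d₂' : Z' →ₗ[k] Y'}
    (fX : X →ₗ[k] X') (fY : Y →ₗ[k] Y') (fZ : Z →ₗ[k] Z')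
    (gX : X' →ₗ[k] X) (gY : Y' →ₗ[k] Y) (gZ : Z' →ₗ[k] Z)
    (hf₁ : d₁' ∘ₗ fY = fX ∘ₗ d₁) (hf₂ : d₂' ∘ₗ fZ = fY ∘ₗ d₂)
    (hg₁ : d₁ ∘ₗ gY = gX ∘ₗ d₁') (hg₂ : d₂ ∘ₗ gZ = gY ∘ₗ d₂')
    (hgf : ∀ y, d₁ y = 0 → gY (fY y) - y ∈ LinearMap.range d₂)
    (hfg : ∀ y, d₁' y = 0 → fY (gY y) - y ∈ LinearMap.range d₂') :
    Nonempty (HomologySucc d₁ d₂ ≃ₗ[k] HomologySucc d₁' d₂') := by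
  have hfk : ∀ y ∈ LinearMap.ker d₁, fY y ∈ LinearMap.ker d₁' := fun y hy => by
    simpa [LinearMap.mem_ker.1 hy] using LinearMap.congr_fun hf₁ y
  have hgk : ∀ y ∈ LinearMap.ker d₁', gY y ∈ LinearMap.ker d₁ := fun y hy => by
    simpa [LinearMap.mem_ker.1 hy] using LinearMap.congr_fun hg₁ y
  refine ⟨LinearEquiv.ofLinearMap
    (Submodule.mapQ _ _ (fY.restrict hfk) ?_) (Submodule.mapQ _ _ (gY.restrict hgk) ?_) ?_ ?_⟩
  · rintro ⟨y, hy⟩ ⟨z, rfl⟩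
    exact ⟨fZ z, LinearMap.congr_fun hf₂ z⟩
  · rintro ⟨y, hy⟩ ⟨z, rfl⟩
    exact ⟨gZ z, LinearMap.congr_fun hg₂ z⟩
  · refine Submodule.linearMap_qext _ (LinearMap.ext fun y => ?_)
    exact (Submodule.Quotient.eq _).2 (hfg y y.2)
  · refine Submodule.linearMap_qext _ (LinearMap.ext fun y => ?_)
    exact (Submodule.Quotient.eq _).2 (hgf y y.2)

/-- Linear maps with mutually inverse (up to boundaries) morphisms between them have isomorphic
cokernels. -/
theorem nonempty_homology0_equiv {k : Type} [Field k] {X Y X' Y' : Type}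
    [AddCommGroup X] [Module k X] [AddCommGroup Y] [Module k Y]
    [AddCommGroup X'] [Module k X'] [AddCommGroup Y'] [Module k Y']
    {d : Y →ₗ[k] X} {d' : Y' →ₗ[k] X'}
    (fX : X →ₗ[k] X') (fY : Y →ₗ[k] Y') (gX : X' →ₗ[k] X) (gY : Y' →ₗ[k] Y)
    (hf : d' ∘ₗ fY = fX ∘ₗ d) (hg : d ∘ₗ gY = gX ∘ₗ d')
    (hgf : ∀ x, gX (fX x) - x ∈ LinearMap.range d)
    (hfg : ∀ x, fX (gX x) - x ∈ LinearMap.range d') :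
    Nonempty (Homology0 d ≃ₗ[k] Homology0 d') := by
  refine ⟨LinearEquiv.ofLinearMap (Submodule.mapQ _ _ fX ?_) (Submodule.mapQ _ _ gX ?_) ?_ ?_⟩
  · rintro _ ⟨y, rfl⟩
    exact ⟨fY y, LinearMap.congr_fun hf y⟩
  · rintro _ ⟨y, rfl⟩
    exact ⟨gY y, LinearMap.congr_fun hg y⟩
  · exact Submodule.linearMap_qext _ (LinearMap.ext fun x => (Submodule.Quotient.eq _).2 (hfg x))
  · exact Submodule.linearMap_qext _ (LinearMap.ext fun x => (Submodule.Quotient.eq _).2 (hgf x))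

/-- The alternating sum of `a i j`, which stands for `δᵢ hⱼ`, cancels against that of `b j i`,
which stands for `hⱼ δᵢ`, up to the two extreme terms. -/
theorem alternating_sum_presimplicialHomotopy {G : Type*} [AddCommGroup G] (n : ℕ)
    (a b : ℕ → ℕ → G)
    (hlt : ∀ i j, i < j → j ≤ n + 1 → a i j = b (j - 1) i)
    (heq : ∀ i, 0 < i → i ≤ n + 1 → a i i = a i (i - 1))
    (hgt : ∀ i j, j + 1 < i → i ≤ n + 2 → a i j = b j (i - 1)) :
    (∑ j ∈ Finset.range (n + 2), ∑ i ∈ Finset.range (n + 3), ((-1 : ℤ) ^ (i + j)) • a i j) +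
      ∑ j ∈ Finset.range (n + 1), ∑ i ∈ Finset.range (n + 2), ((-1 : ℤ) ^ (i + j)) • b j i =
    a 0 0 - a (n + 2) (n + 1) := by
  have hsplit : ∀ j ∈ Finset.range (n + 2),
      ∑ i ∈ Finset.range (n + 3), ((-1 : ℤ) ^ (i + j)) • a i j =
        (∑ i ∈ Finset.range j, ((-1 : ℤ) ^ (i + j)) • b (j - 1) i) + (a j j - a (j + 1) j) -
          ∑ i ∈ Finset.Ico (j + 1) (n + 2), ((-1 : ℤ) ^ (i + j)) • b j i := by
    intro j hj
    have hj' : j < n + 2 := Finset.mem_range.1 hj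
    rw [← Finset.sum_range_add_sum_Ico _ (show j + 2 ≤ n + 3 by omega), Finset.sum_range_succ,
      Finset.sum_range_succ, ← Finset.sum_Ico_add' _ (j + 1) (n + 2) 1]
    have h₁ : ∑ i ∈ Finset.range j, ((-1 : ℤ) ^ (i + j)) • a i j =
        ∑ i ∈ Finset.range j, ((-1 : ℤ) ^ (i + j)) • b (j - 1) i :=
      Finset.sum_congr rfl fun i hi => by
        rw [hlt i j (Finset.mem_range.1 hi) (by omega)]
    have h₂ : ∑ i ∈ Finset.Ico (j + 1) (n + 2), ((-1 : ℤ) ^ (i + 1 + j)) • a (i + 1) j =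
        -∑ i ∈ Finset.Ico (j + 1) (n + 2), ((-1 : ℤ) ^ (i + j)) • b j i := by
      rw [← Finset.sum_neg_distrib]
      refine Finset.sum_congr rfl fun i hi => ?_
      have := Finset.mem_Ico.1 hi
      rw [hgt (i + 1) j (by omega) (by omega), Nat.add_sub_cancel, add_right_comm, pow_succ]
      simp
    have h₃ : (-1 : ℤ) ^ (j + j) = 1 := Even.neg_one_pow ⟨j, rfl⟩
    rw [h₁, h₂, add_right_comm j 1 j, pow_succ, h₃]
    simp only [one_mul, one_smul, neg_smul]
    abel
  have htel : ∑ j ∈ Finset.range (n + 2), (a j j - a (j + 1) j) = a 0 0 - a (n + 2) (n + 1) := by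
    rw [Finset.sum_range_succ]
    have : ∀ j ∈ Finset.range (n + 1), a j j - a (j + 1) j = a j j - a (j + 1) (j + 1) := by
      intro j hj
      rw [heq (j + 1) (by omega) (by have := Finset.mem_range.1 hj; omega), Nat.add_sub_cancel]
    rw [Finset.sum_congr rfl this, Finset.sum_range_sub' fun j => a j j]
    abel
  have hlow : ∑ j ∈ Finset.range (n + 2), ∑ i ∈ Finset.range j,
        ((-1 : ℤ) ^ (i + j)) • b (j - 1) i =
      -∑ j ∈ Finset.range (n + 1), ∑ i ∈ Finset.range (j + 1), ((-1 : ℤ) ^ (i + j)) • b j i := by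
    rw [Finset.sum_range_succ']
    simp [← add_assoc, pow_succ]
  have hup : ∑ j ∈ Finset.range (n + 2), ∑ i ∈ Finset.Ico (j + 1) (n + 2),
        ((-1 : ℤ) ^ (i + j)) • b j i =
      ∑ j ∈ Finset.range (n + 1), ∑ i ∈ Finset.Ico (j + 1) (n + 2),
        ((-1 : ℤ) ^ (i + j)) • b j i := by
    rw [Finset.sum_range_succ]
    simp
  have hb : ∑ j ∈ Finset.range (n + 1), ∑ i ∈ Finset.range (n + 2), ((-1 : ℤ) ^ (i + j)) • b j i =
      (∑ j ∈ Finset.range (n + 1), ∑ i ∈ Finset.range (j + 1), ((-1 : ℤ) ^ (i + j)) • b j i) +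
      ∑ j ∈ Finset.range (n + 1), ∑ i ∈ Finset.Ico (j + 1) (n + 2),
        ((-1 : ℤ) ^ (i + j)) • b j i := by
    rw [← Finset.sum_add_distrib]
    refine Finset.sum_congr rfl fun j hj => ?_
    rw [Finset.sum_range_add_sum_Ico _ (by have := Finset.mem_range.1 hj; omega)]
  rw [Finset.sum_congr rfl hsplit, Finset.sum_sub_distrib, Finset.sum_add_distrib, htel, hlow,
    hup, hb]
  abel

/-- The boundary map of a simplicial module: the alternating sum of its face maps. -/
def SimplicialLeftModule.boundary (ℬ : SimplicialLeftModule k 𝓐 B) (n : ℕ) :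
    B (n + 1) →ₗ[k] B n :=
  ∑ i ∈ Finset.range (n + 2), ((-1 : ℤ) ^ i) • ℬ.δ n i

theorem SimplicialLeftModule.boundary_apply (ℬ : SimplicialLeftModule k 𝓐 B) (n : ℕ)
    (b : B (n + 1)) :
    ℬ.boundary n b = ∑ i ∈ Finset.range (n + 2), ((-1 : ℤ) ^ i) • ℬ.δ n i b := by
  simp [SimplicialLeftModule.boundary]

theorem PresimplicialMorphism.boundary_comm {ℬ : SimplicialLeftModule k 𝓐 B}
    {𝒞 : SimplicialLeftModule k 𝓐 C} (φ : PresimplicialMorphism ℬ 𝒞) (n : ℕ) (b : B (n + 1)) :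
    𝒞.boundary n (φ.f (n + 1) b) = φ.f n (ℬ.boundary n b) := by
  rw [SimplicialLeftModule.boundary_apply, SimplicialLeftModule.boundary_apply, map_sum]
  refine Finset.sum_congr rfl fun i hi => ?_
  rw [map_zsmul, φ.comm n i (by have := Finset.mem_range.1 hi; omega)]

/-- The chain homotopy given by the alternating sum of the maps of a presimplicial homotopy. -/
def chainHomotopy (h : (n : ℕ) → ℕ → (B n →ₗ[k] C (n + 1))) (n : ℕ) : B n →ₗ[k] C (n + 1) :=
  ∑ j ∈ Finset.range (n + 1), ((-1 : ℤ) ^ j) • h n j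

theorem chainHomotopy_apply (h : (n : ℕ) → ℕ → (B n →ₗ[k] C (n + 1))) (n : ℕ) (b : B n) :
    chainHomotopy h n b = ∑ j ∈ Finset.range (n + 1), ((-1 : ℤ) ^ j) • h n j b := by
  simp [chainHomotopy]

theorem IsPresimplicialHomotopy.boundary_zero {ℬ : SimplicialLeftModule k 𝓐 B}
    {𝒞 : SimplicialLeftModule k 𝓐 C} {φ ψ : PresimplicialMorphism ℬ 𝒞}
    {h : (n : ℕ) → ℕ → (B n →ₗ[k] C (n + 1))} (H : IsPresimplicialHomotopy φ ψ h) (b : B 0) :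
    𝒞.boundary 0 (chainHomotopy h 0 b) = φ.f 0 b - ψ.f 0 b := by
  obtain ⟨-, -, -, -, h₀, h₁⟩ := H
  rw [SimplicialLeftModule.boundary_apply, chainHomotopy_apply, ← h₀, ← h₁]
  simp [Finset.sum_range_succ, sub_eq_add_neg]

theorem IsPresimplicialHomotopy.boundary_succ {ℬ : SimplicialLeftModule k 𝓐 B}
    {𝒞 : SimplicialLeftModule k 𝓐 C} {φ ψ : PresimplicialMorphism ℬ 𝒞}
    {h : (n : ℕ) → ℕ → (B n →ₗ[k] C (n + 1))} (H : IsPresimplicialHomotopy φ ψ h) (n : ℕ)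
    (b : B (n + 1)) :
    𝒞.boundary (n + 1) (chainHomotopy h (n + 1) b) + chainHomotopy h n (ℬ.boundary n b) =
      φ.f (n + 1) b - ψ.f (n + 1) b := by
  obtain ⟨-, hlt, heq, hgt, h₀, h₁⟩ := H
  rw [← h₀, ← h₁, ← alternating_sum_presimplicialHomotopy n
    (fun i j => 𝒞.δ (n + 1) i (h (n + 1) j b)) (fun j i => h n j (ℬ.δ n i b))
    (fun i j hi hj => hlt n i j hi hj b) (fun i hi hi' => heq (n + 1) i hi hi' b)
    (fun i j hi hj => hgt n i j hi hj b)]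
  congr 1
  · rw [SimplicialLeftModule.boundary_apply, chainHomotopy_apply, Finset.sum_comm]
    simp only [map_sum, map_zsmul, Finset.smul_sum, smul_smul, pow_add]
  · rw [chainHomotopy_apply, SimplicialLeftModule.boundary_apply]
    simp only [map_sum, map_zsmul, Finset.smul_sum, smul_smul, pow_add, mul_comm]

/-- The map `M ⊗ B n → M ⊗ C m` of balanced tensor products induced by an equivariant linear
map `B n → C m`. -/
def coeffMap {k A : Type} (M : Type) [Field k] [Ring A] [Algebra k A] [AddCommGroup M]
    [Module k M] [Module A M] [Module Aᵐᵒᵖ M]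
    {B C : ℕ → Type} [∀ n, AddCommGroup (B n)] [∀ n, Module k (B n)]
    [∀ n, AddCommGroup (C n)] [∀ n, Module k (C n)]
    (ℬ : SimplicialLeftModule k (constAlg k (A ⊗[k] Aᵐᵒᵖ)) B)
    (𝒞 : SimplicialLeftModule k (constAlg k (A ⊗[k] Aᵐᵒᵖ)) C) {n m : ℕ}
    (f : B n →ₗ[k] C m) (hf : ∀ r b, f (ℬ.act n r b) = 𝒞.act m r (f b)) :
    CoeffTen k A M ℬ n →ₗ[k] CoeffTen k A M 𝒞 m :=
  Submodule.mapQ _ _ (f.lTensor M) <| Submodule.span_le.2 <| by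
    rintro _ ⟨a, b, x, c, rfl⟩
    refine Submodule.subset_span ⟨a, b, x, f c, ?_⟩
    rw [map_sub, LinearMap.lTensor_tmul, LinearMap.lTensor_tmul, hf]

@[simp]
theorem coeffMap_mk {k A M : Type} [Field k] [Ring A] [Algebra k A] [AddCommGroup M]
    [Module k M] [Module A M] [Module Aᵐᵒᵖ M]
    {B C : ℕ → Type} [∀ n, AddCommGroup (B n)] [∀ n, Module k (B n)]
    [∀ n, AddCommGroup (C n)] [∀ n, Module k (C n)]
    (ℬ : SimplicialLeftModule k (constAlg k (A ⊗[k] Aᵐᵒᵖ)) B)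
    (𝒞 : SimplicialLeftModule k (constAlg k (A ⊗[k] Aᵐᵒᵖ)) C) {n m : ℕ}
    (f : B n →ₗ[k] C m) (hf : ∀ r b, f (ℬ.act n r b) = 𝒞.act m r (f b)) (x : M) (b : B n) :
    coeffMap M ℬ 𝒞 f hf (Submodule.Quotient.mk (x ⊗ₜ[k] b)) =
      Submodule.Quotient.mk (x ⊗ₜ[k] f b) :=
  rfl

theorem CoeffTen.linearMap_ext {k A M : Type} [Field k] [Ring A] [Algebra k A] [AddCommGroup M]
    [Module k M] [Module A M] [Module Aᵐᵒᵖ M]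
    {C : ℕ → Type} [∀ n, AddCommGroup (C n)] [∀ n, Module k (C n)]
    {𝒞 : SimplicialLeftModule k (constAlg k (A ⊗[k] Aᵐᵒᵖ)) C} {n : ℕ}
    {N : Type*} [AddCommGroup N] [Module k N] {f g : CoeffTen k A M 𝒞 n →ₗ[k] N}
    (h : ∀ (x : M) (c : C n), f (Submodule.Quotient.mk (x ⊗ₜ[k] c)) =
      g (Submodule.Quotient.mk (x ⊗ₜ[k] c))) : f = g :=
  Submodule.linearMap_qext _ (TensorProduct.ext' h)

theorem boundary_act {k R : Type} [Field k] [Ring R] [Algebra k R]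
    {B : ℕ → Type} [∀ n, AddCommGroup (B n)] [∀ n, Module k (B n)]
    (ℬ : SimplicialLeftModule k (constAlg k R) B) (n : ℕ) (r : R) (b : B (n + 1)) :
    ℬ.boundary n (ℬ.act (n + 1) r b) = ℬ.act n r (ℬ.boundary n b) := by
  rw [SimplicialLeftModule.boundary_apply, SimplicialLeftModule.boundary_apply, map_sum]
  refine Finset.sum_congr rfl fun i hi => ?_
  rw [map_zsmul, ℬ.δ_act n i (by have := Finset.mem_range.1 hi; omega)]
  rfl

theorem IsPresimplicialHomotopy.chainHomotopy_act {k R : Type} [Field k] [Ring R] [Algebra k R]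
    {B C : ℕ → Type} [∀ n, AddCommGroup (B n)] [∀ n, Module k (B n)]
    [∀ n, AddCommGroup (C n)] [∀ n, Module k (C n)]
    {ℬ : SimplicialLeftModule k (constAlg k R) B} {𝒞 : SimplicialLeftModule k (constAlg k R) C}
    {φ ψ : PresimplicialMorphism ℬ 𝒞} {h : (n : ℕ) → ℕ → (B n →ₗ[k] C (n + 1))}
    (H : IsPresimplicialHomotopy φ ψ h) (n : ℕ) (r : R) (b : B n) :
    chainHomotopy h n (ℬ.act n r b) = 𝒞.act (n + 1) r (chainHomotopy h n b) := by
  rw [chainHomotopy_apply, chainHomotopy_apply, map_sum]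
  refine Finset.sum_congr rfl fun i hi => ?_
  rw [map_zsmul, H.1 n i (by have := Finset.mem_range.1 hi; omega)]
  rfl

section Coefficients

variable {k A M : Type} [Field k] [Ring A] [Algebra k A] [AddCommGroup M]
  [Module k M] [Module A M] [Module Aᵐᵒᵖ M]
  {B C : ℕ → Type} [∀ n, AddCommGroup (B n)] [∀ n, Module k (B n)]
  [∀ n, AddCommGroup (C n)] [∀ n, Module k (C n)]
  {ℬ : SimplicialLeftModule k (constAlg k (A ⊗[k] Aᵐᵒᵖ)) B}
  {𝒞 : SimplicialLeftModule k (constAlg k (A ⊗[k] Aᵐᵒᵖ)) C}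

variable (M) in
/-- The boundary map of the complex `ℳ(M) ⊗ 𝒞`. -/
def coeffBoundary (𝒞 : SimplicialLeftModule k (constAlg k (A ⊗[k] Aᵐᵒᵖ)) C) (n : ℕ) :
    CoeffTen k A M 𝒞 (n + 1) →ₗ[k] CoeffTen k A M 𝒞 n :=
  coeffMap M 𝒞 𝒞 (𝒞.boundary n) (boundary_act 𝒞 n)

theorem coeffBoundary_mk (n : ℕ) (m : M) (c : C (n + 1)) :
    coeffBoundary M 𝒞 n (Submodule.Quotient.mk (m ⊗ₜ[k] c)) =
      ∑ i ∈ Finset.range (n + 2), ((-1 : ℤ) ^ i) •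
        (Submodule.Quotient.mk (m ⊗ₜ[k] 𝒞.δ n i c) : CoeffTen k A M 𝒞 n) := by
  rw [coeffBoundary, coeffMap_mk, SimplicialLeftModule.boundary_apply, TensorProduct.tmul_sum,
    ← Submodule.mkQ_apply, map_sum]
  refine Finset.sum_congr rfl fun i _ => ?_
  rw [TensorProduct.tmul_smul, map_zsmul, Submodule.mkQ_apply]

theorem sum_eq_coeffBoundary {n : ℕ}
    {d : ℕ → (CoeffTen k A M 𝒞 (n + 1) →ₗ[k] CoeffTen k A M 𝒞 n)}
    (hd : ∀ i, i ≤ n + 1 → ∀ (m : M) (c : C (n + 1)),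
      d i (Submodule.Quotient.mk (m ⊗ₜ[k] c)) = Submodule.Quotient.mk (m ⊗ₜ[k] 𝒞.δ n i c)) :
    ∑ i ∈ Finset.range (n + 2), ((-1 : ℤ) ^ i) • d i = coeffBoundary M 𝒞 n := by
  refine CoeffTen.linearMap_ext fun m c => ?_
  rw [coeffBoundary_mk, LinearMap.sum_apply]
  refine Finset.sum_congr rfl fun i hi => ?_
  rw [LinearMap.smul_apply, hd i (by have := Finset.mem_range.1 hi; omega)]

theorem coeffBoundary_comp_coeffMap (φ : PresimplicialMorphism ℬ 𝒞) (n : ℕ) :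
    coeffBoundary M 𝒞 n ∘ₗ coeffMap M ℬ 𝒞 (φ.f (n + 1)) (φ.f_act (n + 1)) =
      coeffMap M ℬ 𝒞 (φ.f n) (φ.f_act n) ∘ₗ coeffBoundary M ℬ n := by
  refine CoeffTen.linearMap_ext fun m b => ?_
  simp only [coeffBoundary, LinearMap.comp_apply, coeffMap_mk, φ.boundary_comm]

theorem IsPresimplicialHomotopy.coeffMap_sub_mem_range_zero {φ : PresimplicialMorphism ℬ 𝒞}
    {ψ : PresimplicialMorphism 𝒞 ℬ} {h : (n : ℕ) → ℕ → (B n →ₗ[k] B (n + 1))}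
    (H : IsPresimplicialHomotopy (ψ.comp φ) (PresimplicialMorphism.id ℬ) h)
    (x : CoeffTen k A M ℬ 0) :
    coeffMap M 𝒞 ℬ (ψ.f 0) (ψ.f_act 0) (coeffMap M ℬ 𝒞 (φ.f 0) (φ.f_act 0) x) - x ∈
      LinearMap.range (coeffBoundary M ℬ 0) := by
  have key : coeffBoundary M ℬ 0 ∘ₗ coeffMap M ℬ ℬ (chainHomotopy h 0) (H.chainHomotopy_act 0) =
      coeffMap M 𝒞 ℬ (ψ.f 0) (ψ.f_act 0) ∘ₗ coeffMap M ℬ 𝒞 (φ.f 0) (φ.f_act 0) -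
        LinearMap.id := by
    refine CoeffTen.linearMap_ext fun m b => ?_
    simp only [coeffBoundary, LinearMap.comp_apply, LinearMap.sub_apply, coeffMap_mk,
      H.boundary_zero, TensorProduct.tmul_sub]
    rfl
  exact ⟨_, LinearMap.congr_fun key x⟩

theorem IsPresimplicialHomotopy.coeffMap_sub_mem_range_succ {φ : PresimplicialMorphism ℬ 𝒞}
    {ψ : PresimplicialMorphism 𝒞 ℬ} {h : (n : ℕ) → ℕ → (B n →ₗ[k] B (n + 1))}
    (H : IsPresimplicialHomotopy (ψ.comp φ) (PresimplicialMorphism.id ℬ) h) (n : ℕ)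
    (x : CoeffTen k A M ℬ (n + 1)) (hx : coeffBoundary M ℬ n x = 0) :
    coeffMap M 𝒞 ℬ (ψ.f (n + 1)) (ψ.f_act (n + 1))
        (coeffMap M ℬ 𝒞 (φ.f (n + 1)) (φ.f_act (n + 1)) x) - x ∈
      LinearMap.range (coeffBoundary M ℬ (n + 1)) := by
  have key : coeffBoundary M ℬ (n + 1) ∘ₗ
        coeffMap M ℬ ℬ (chainHomotopy h (n + 1)) (H.chainHomotopy_act (n + 1)) +
        coeffMap M ℬ ℬ (chainHomotopy h n) (H.chainHomotopy_act n) ∘ₗ coeffBoundary M ℬ n =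
      coeffMap M 𝒞 ℬ (ψ.f (n + 1)) (ψ.f_act (n + 1)) ∘ₗ
        coeffMap M ℬ 𝒞 (φ.f (n + 1)) (φ.f_act (n + 1)) - LinearMap.id := by
    refine CoeffTen.linearMap_ext fun m b => ?_
    simp only [coeffBoundary, LinearMap.comp_apply, LinearMap.sub_apply, LinearMap.add_apply,
      coeffMap_mk, ← Submodule.Quotient.mk_add, ← TensorProduct.tmul_add, H.boundary_succ,
      TensorProduct.tmul_sub]
    rfl
  refine ⟨coeffMap M ℬ ℬ (chainHomotopy h (n + 1)) (H.chainHomotopy_act (n + 1)) x,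
    Eq.trans ?_ (LinearMap.congr_fun key x)⟩
  simp [hx]

/-- A presimplicial homotopy equivalence induces isomorphisms on the homology of the complexes
with coefficients in `M`. -/
theorem IsPresimplicialHomotopyEquivalence.nonempty_homology_equiv
    {φ : PresimplicialMorphism ℬ 𝒞} (hφ : IsPresimplicialHomotopyEquivalence φ) :
    Nonempty (Homology0 (coeffBoundary M ℬ 0) ≃ₗ[k] Homology0 (coeffBoundary M 𝒞 0)) ∧
    ∀ n, Nonempty (HomologySucc (coeffBoundary M ℬ n) (coeffBoundary M ℬ (n + 1)) ≃ₗ[k]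
      HomologySucc (coeffBoundary M 𝒞 n) (coeffBoundary M 𝒞 (n + 1))) := by
  obtain ⟨ψ, ⟨h, H⟩, ⟨t, T⟩⟩ := hφ
  exact ⟨nonempty_homology0_equiv _ _ _ _
      (coeffBoundary_comp_coeffMap φ 0) (coeffBoundary_comp_coeffMap ψ 0)
      H.coeffMap_sub_mem_range_zero T.coeffMap_sub_mem_range_zero,
    fun n => nonempty_homologySucc_equiv _ _ _ _ _ _
      (coeffBoundary_comp_coeffMap φ n) (coeffBoundary_comp_coeffMap φ (n + 1))
      (coeffBoundary_comp_coeffMap ψ n) (coeffBoundary_comp_coeffMap ψ (n + 1))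
      (H.coeffMap_sub_mem_range_succ n) (T.coeffMap_sub_mem_range_succ n)⟩

end Coefficients

theorem tensor_piTensorProduct_ext {k A M : Type} [Field k] [Ring A] [Algebra k A]
    [AddCommGroup M] [Module k M] {ι N : Type*} [AddCommGroup N] [Module k N]
    {f g : (M ⊗[k] (⨂[k] (_ : ι), A)) →ₗ[k] N}
    (h : ∀ (m : M) (v : ι → A), f (m ⊗ₜ[k] tprod k v) = g (m ⊗ₜ[k] tprod k v)) : f = g := by
  refine TensorProduct.ext (LinearMap.ext fun m => PiTensorProduct.ext ?_)
  ext v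
  exact h m v

section Bar

variable {k A M : Type} [Field k] [Ring A] [Algebra k A] [AddCommGroup M]
  [Module k M] [Module A M] [Module Aᵐᵒᵖ M]

/-- The middle entries of a tuple. -/
def barMid {A : Type} {n : ℕ} (v : Fin (n + 2) → A) : Fin n → A :=
  fun j => v j.castSucc.succ

theorem barMid_update_zero {A : Type} {n : ℕ} [DecidableEq (Fin (n + 2))] (v : Fin (n + 2) → A)
    (a : A) : barMid (Function.update v 0 a) = barMid v :=
  funext fun _ => Function.update_of_ne (by simp [Fin.ext_iff]) _ _

theorem barMid_update_last {A : Type} {n : ℕ} [DecidableEq (Fin (n + 2))] (v : Fin (n + 2) → A)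
    (a : A) : barMid (Function.update v (Fin.last _) a) = barMid v :=
  funext fun j => Function.update_of_ne (by simpa [Fin.ext_iff] using j.2.ne) _ _

theorem barMid_update_castSucc_succ {A : Type} {n : ℕ} [DecidableEq (Fin (n + 2))]
    (v : Fin (n + 2) → A) (j : Fin n) (a : A) :
    barMid (Function.update v j.castSucc.succ a) = Function.update (barMid v) j a := by
  ext l
  simp only [barMid, Function.update_apply, Fin.succ_inj, Fin.castSucc_inj]

theorem Fin.eq_zero_or_eq_last_or_eq_castSucc_succ {n : ℕ} (i : Fin (n + 2)) :
    i = 0 ∨ i = Fin.last _ ∨ ∃ j : Fin n, i = j.castSucc.succ := by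
  rcases Nat.eq_zero_or_pos (i : ℕ) with h | h
  · exact .inl (Fin.ext h)
  · rcases (Fin.le_last i).eq_or_lt with h' | h'
    · exact .inr (.inl h')
    · have : (i : ℕ) < n + 1 := h'
      exact .inr (.inr ⟨⟨i - 1, by omega⟩, Fin.ext (by simp; omega)⟩)

variable (k A) in
/-- The linear map `a₁ ⊗ ⋯ ⊗ aₙ ↦ 1 ⊗ a₁ ⊗ ⋯ ⊗ aₙ ⊗ 1`. -/
def barUnit (n : ℕ) : (⨂[k] (_ : Fin n), A) →ₗ[k] (⨂[k] (_ : Fin (n + 2)), A) :=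
  PiTensorProduct.lift <| (LinearMap.applyₗ (1 : A)).compMultilinearMap
    ((tprod k : MultilinearMap k (fun _ : Fin (n + 2) => A) _).curryLeft 1).curryRight

@[simp]
theorem barUnit_tprod (n : ℕ) (v : Fin n → A) :
    barUnit k A n (tprod k v) =
      tprod k (Fin.cons (1 : A) (Fin.snoc (α := fun _ => A) v 1) : Fin (n + 2) → A) := by
  simp [barUnit]

variable {ℬ : SimplicialLeftModule k (constAlg k (A ⊗[k] Aᵐᵒᵖ))
    (fun n => ⨂[k] (_ : Fin (n + 2)), A)}

theorem CoeffTen.linearMap_ext_tprod {N : Type*} [AddCommGroup N] [Module k N] {n : ℕ}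
    {f g : CoeffTen k A M ℬ n →ₗ[k] N}
    (h : ∀ (m : M) (v : Fin (n + 2) → A), f (Submodule.Quotient.mk (m ⊗ₜ[k] tprod k v)) =
      g (Submodule.Quotient.mk (m ⊗ₜ[k] tprod k v))) : f = g :=
  Submodule.linearMap_qext _ (tensor_piTensorProduct_ext h)

variable [IsScalarTower k A M] [IsScalarTower k Aᵐᵒᵖ M]

variable (k A M) in
/-- The linear map `m ⊗ (a₀ ⊗ ⋯ ⊗ aₙ₊₁) ↦ aₙ₊₁ m a₀ ⊗ (a₁ ⊗ ⋯ ⊗ aₙ)`. -/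
def barContract (n : ℕ) :
    (M ⊗[k] (⨂[k] (_ : Fin (n + 2)), A)) →ₗ[k] (M ⊗[k] (⨂[k] (_ : Fin n), A)) :=
  TensorProduct.lift <| LinearMap.flip <| PiTensorProduct.lift
    { toFun v := (TensorProduct.mk k M _).flip (tprod k (barMid v)) ∘ₗ
        Algebra.lsmul k k M (v (Fin.last _)) ∘ₗ Algebra.lsmul k k M (op (v 0))
      map_update_add' := by
        intro _ v i x y
        ext m
        have h₀ : (0 : Fin (n + 2)) ≠ Fin.last _ := (Fin.last_pos).ne
        obtain rfl | rfl | ⟨j, rfl⟩ := i.eq_zero_or_eq_last_or_eq_castSucc_succ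
        · simp [barMid_update_zero, h₀.symm]
        · simp [barMid_update_last, h₀]
        · have h₁ : Fin.last _ ≠ j.castSucc.succ := by simpa [Fin.ext_iff] using j.2.ne'
          have h₂ : 0 ≠ j.castSucc.succ := by simp [Fin.ext_iff]
          simp [barMid_update_castSucc_succ, h₁, h₂]
      map_update_smul' := by
        intro _ v i c x
        ext m
        have h₀ : (0 : Fin (n + 2)) ≠ Fin.last _ := (Fin.last_pos).ne
        obtain rfl | rfl | ⟨j, rfl⟩ := i.eq_zero_or_eq_last_or_eq_castSucc_succ
        · simp [barMid_update_zero, h₀.symm, TensorProduct.smul_tmul',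
            smul_comm _ c]
        · simp [barMid_update_last, h₀, TensorProduct.smul_tmul']
        · have h₁ : Fin.last _ ≠ j.castSucc.succ := by simpa [Fin.ext_iff] using j.2.ne'
          have h₂ : 0 ≠ j.castSucc.succ := by simp [Fin.ext_iff]
          simp [barMid_update_castSucc_succ, h₁, h₂] }

@[simp]
theorem barContract_tmul_tprod (n : ℕ) (m : M) (v : Fin (n + 2) → A) :
    barContract k A M n (m ⊗ₜ[k] tprod k v) =
      (v (Fin.last _) • op (v 0) • m) ⊗ₜ[k] tprod k (barMid v) := by
  simp [barContract]

theorem barAct_barUnit {A : Type} [Ring A] {n : ℕ} (v : Fin (n + 2) → A) :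
    barAct n (v 0) (v (Fin.last _))
      (Fin.cons (1 : A) (Fin.snoc (α := fun _ => A) (barMid v) 1) : Fin (n + 2) → A) = v := by
  ext i
  obtain rfl | rfl | ⟨j, rfl⟩ := i.eq_zero_or_eq_last_or_eq_castSucc_succ
  · simp [barAct]
  · rw [← Fin.succ_last]
    simp [barAct]
  · have := j.2.ne
    simp [barAct, this]
    rfl

variable [SMulCommClass A Aᵐᵒᵖ M]

theorem coeffRel_le_ker_barContract
    (hbact : ∀ n (a b : A) (v : Fin (n + 2) → A),
      ℬ.act n (a ⊗ₜ[k] op b) (tprod k v) = tprod k (barAct n a b v)) (n : ℕ) :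
    coeffRel k A M ℬ n ≤ LinearMap.ker (barContract k A M n) := by
  refine Submodule.span_le.2 ?_
  rintro _ ⟨a, b, m, c, rfl⟩
  rw [SetLike.mem_coe, LinearMap.mem_ker, map_sub, sub_eq_zero]
  have h : barContract k A M n ∘ₗ
        (Algebra.lsmul k k M b ∘ₗ Algebra.lsmul k k M (op a)).rTensor _ =
      barContract k A M n ∘ₗ (ℬ.act n (a ⊗ₜ[k] op b)).lTensor M := by
    refine tensor_piTensorProduct_ext fun m v => ?_
    have h₀ : barAct n a b v 0 = a * v 0 := by simp [barAct]
    have h₁ : barAct n a b v (Fin.last _) = v (Fin.last _) * b := by simp [barAct]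
    have h₂ : barMid (barAct n a b v) = barMid v := by
      ext j
      have := j.2.ne
      simp [barMid, barAct, this]
    simp [hbact, h₀, h₁, h₂, mul_smul, smul_comm]
  exact LinearMap.congr_fun h (m ⊗ₜ[k] c)

/-- The `n`-th term of `ℳ(M) ⊗ ℬ(A)` is the `n`-th term of the standard Hochschild complex. -/
def barEquiv (hbact : ∀ n (a b : A) (v : Fin (n + 2) → A),
      ℬ.act n (a ⊗ₜ[k] op b) (tprod k v) = tprod k (barAct n a b v)) (n : ℕ) :
    CoeffTen k A M ℬ n ≃ₗ[k] M ⊗[k] (⨂[k] (_ : Fin n), A) :=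
  LinearEquiv.ofLinearMap
    (Submodule.liftQ _ (barContract k A M n) (coeffRel_le_ker_barContract hbact n))
    (Submodule.mkQ _ ∘ₗ (barUnit k A n).lTensor M)
    (by
      refine tensor_piTensorProduct_ext fun m v => ?_
      have h : barMid (Fin.cons (1 : A) (Fin.snoc (α := fun _ => A) v 1) : Fin (n + 2) → A) = v := by
        ext j
        simp [barMid]
      simp [h, ← Fin.succ_last])
    (by
      refine CoeffTen.linearMap_ext_tprod fun m v => ?_
      refine (Submodule.Quotient.eq _).2 (Submodule.subset_span
        ⟨v 0, v (Fin.last _), m, barUnit k A n (tprod k (barMid v)), ?_⟩)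
      rw [barUnit_tprod, hbact, barAct_barUnit]
      simp)

@[simp]
theorem barEquiv_mk_tprod (hbact : ∀ n (a b : A) (v : Fin (n + 2) → A),
      ℬ.act n (a ⊗ₜ[k] op b) (tprod k v) = tprod k (barAct n a b v)) (n : ℕ) (m : M)
    (v : Fin (n + 2) → A) :
    barEquiv hbact n (Submodule.Quotient.mk (m ⊗ₜ[k] tprod k v)) =
      (v (Fin.last _) • op (v 0) • m) ⊗ₜ[k] tprod k (barMid v) :=
  barContract_tmul_tprod n m v

theorem barEquiv_comp_coeffBoundary
    (hbδ : ∀ n i, i ≤ n + 1 → ∀ v : Fin (n + 3) → A,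
      ℬ.δ n i (tprod k v) = tprod k (barFace n i v))
    (hbact : ∀ n (a b : A) (v : Fin (n + 2) → A),
      ℬ.act n (a ⊗ₜ[k] op b) (tprod k v) = tprod k (barAct n a b v)) (n : ℕ)
    {hd : ℕ → ((M ⊗[k] (⨂[k] (_ : Fin (n + 1)), A)) →ₗ[k] (M ⊗[k] (⨂[k] (_ : Fin n), A)))}
    (hd0 : ∀ (m : M) (v : Fin (n + 1) → A),
      hd 0 (m ⊗ₜ[k] tprod k v) = (op (v 0) • m) ⊗ₜ[k] tprod k (fun j : Fin n => v j.succ))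
    (hdmid : ∀ i, 1 ≤ i → i ≤ n → ∀ (m : M) (v : Fin (n + 1) → A),
      hd i (m ⊗ₜ[k] tprod k v) = m ⊗ₜ[k] tprod k (hochMerge n i v))
    (hdlast : ∀ (m : M) (v : Fin (n + 1) → A),
      hd (n + 1) (m ⊗ₜ[k] tprod k v) =
        (v (Fin.last n) • m) ⊗ₜ[k] tprod k (fun j : Fin n => v j.castSucc)) :
    (barEquiv (M := M) hbact n).toLinearMap ∘ₗ coeffBoundary M ℬ n =
      (∑ i ∈ Finset.range (n + 2), ((-1 : ℤ) ^ i) • hd i) ∘ₗ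
        (barEquiv hbact (n + 1)).toLinearMap := by
  refine CoeffTen.linearMap_ext_tprod fun m v => ?_
  rw [LinearMap.comp_apply, coeffBoundary_mk, map_sum, LinearMap.comp_apply,
    LinearMap.sum_apply]
  refine Finset.sum_congr rfl fun i hi => ?_
  have hi' : i ≤ n + 1 := by have := Finset.mem_range.1 hi; omega
  rw [map_zsmul, LinearMap.smul_apply, hbδ n i hi']
  congr 1
  simp only [LinearEquiv.coe_coe, barEquiv_mk_tprod]
  rcases Nat.eq_zero_or_pos i with rfl | hpos
  · rw [hd0]
    have h₀ : barFace n 0 v 0 = v 0 * v 1 := by simp [barFace]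
    have h₁ : barFace n 0 v (Fin.last _) = v (Fin.last _) := by simp [barFace, Fin.last]
    have h₂ : barMid (barFace n 0 v) = fun j => barMid v j.succ := by
      ext j
      simp [barFace, barMid]
      rfl
    rw [h₀, h₁, h₂, op_mul, mul_smul, smul_comm]
    rfl
  · rcases hi'.eq_or_lt with rfl | hlt
    · rw [hdlast]
      have h₀ : barFace n (n + 1) v 0 = v 0 := by simp [barFace]
      have h₁ : barFace n (n + 1) v (Fin.last _) =
          v (Fin.last _).castSucc * v (Fin.last _) := by
        simp [barFace, Fin.last]
      have h₂ : barMid (barFace n (n + 1) v) = fun j => barMid v j.castSucc := by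
        ext j
        simp [barFace, barMid]
        rfl
      rw [h₀, h₁, h₂, mul_smul]
      rfl
    · rw [hdmid i hpos (by omega)]
      have h₀ : barFace n i v 0 = v 0 := by simp [barFace, hpos]
      have h₁ : barFace n i v (Fin.last _) = v (Fin.last _) := by
        have e₁ : ¬ n + 1 < i := by omega
        have e₂ : ¬ n + 1 = i := by omega
        simp [barFace, Fin.last, e₁, e₂]
      have h₂ : barMid (barFace n i v) = hochMerge n i (barMid v) := by
        ext j
        have e₁ : (j : ℕ) + 1 < i ↔ (j : ℕ) < i - 1 := by omega
        have e₂ : (j : ℕ) + 1 = i ↔ (j : ℕ) = i - 1 := by omega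
        simp only [barFace, barMid, hochMerge, Fin.val_castSucc, Fin.val_succ, e₁, e₂]
        rfl
      rw [h₀, h₁, h₂]

end Bar

/-- If `𝒞` is a simplicial left module over the constant simplicial `k`-algebra on
`A ⊗ Aᵒᵖ` and there is a presimplicial homotopy equivalence `ℬ(A) → 𝒞` from the bar
resolution, then the Hochschild homology of `A` with coefficients in the `A`-bimodule
`M` (the homology of the standard Hochschild complex, with `n`-th term `M ⊗ A^{⊗n}`
and the usual Hochschild boundary) is isomorphic to the homology of the chain complex
`ℳ(M) ⊗_{𝒜(A ⊗ Aᵒᵖ)} 𝒞`. -/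
theorem hochschildHomology_iso_of_presimplicialHomotopyEquivalence
    (k A M : Type) [Field k] [Ring A] [Algebra k A]
    [AddCommGroup M] [Module k M] [Module A M] [Module Aᵐᵒᵖ M]
    [IsScalarTower k A M] [IsScalarTower k Aᵐᵒᵖ M] [SMulCommClass A Aᵐᵒᵖ M]
    {C : ℕ → Type} [∀ n, AddCommGroup (C n)] [∀ n, Module k (C n)]
    (ℬbar : SimplicialLeftModule k (constAlg k (A ⊗[k] Aᵐᵒᵖ))
      (fun n => ⨂[k] (_ : Fin (n + 2)), A))
    (hbδ : ∀ n i, i ≤ n + 1 → ∀ v : Fin (n + 3) → A,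
      ℬbar.δ n i (tprod k v) = tprod k (barFace n i v))
    (hbσ : ∀ n i (hi : i ≤ n), ∀ v : Fin (n + 2) → A,
      ℬbar.σ n i (tprod k v) = tprod k (barDegen n i hi v))
    (hbact : ∀ n (a b : A) (v : Fin (n + 2) → A),
      ℬbar.act n (a ⊗ₜ[k] op b) (tprod k v) = tprod k (barAct n a b v))
    (𝒞 : SimplicialLeftModule k (constAlg k (A ⊗[k] Aᵐᵒᵖ)) C)
    (hfe : ∃ φ : PresimplicialMorphism ℬbar 𝒞, IsPresimplicialHomotopyEquivalence φ)
    (hd : (n : ℕ) → ℕ →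
      ((M ⊗[k] (⨂[k] (_ : Fin (n + 1)), A)) →ₗ[k] (M ⊗[k] (⨂[k] (_ : Fin n), A))))
    (hd0 : ∀ n (m : M) (v : Fin (n + 1) → A),
      hd n 0 (m ⊗ₜ[k] tprod k v) = (op (v 0) • m) ⊗ₜ[k] tprod k (fun j : Fin n => v j.succ))
    (hdmid : ∀ n i, 1 ≤ i → i ≤ n → ∀ (m : M) (v : Fin (n + 1) → A),
      hd n i (m ⊗ₜ[k] tprod k v) = m ⊗ₜ[k] tprod k (hochMerge n i v))
    (hdlast : ∀ n (m : M) (v : Fin (n + 1) → A),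
      hd n (n + 1) (m ⊗ₜ[k] tprod k v) =
        (v ⟨n, by omega⟩ • m) ⊗ₜ[k] tprod k (fun j : Fin n => v j.castSucc))
    (DC : (n : ℕ) → ℕ → (CoeffTen k A M 𝒞 (n + 1) →ₗ[k] CoeffTen k A M 𝒞 n))
    (hDC : ∀ n i, i ≤ n + 1 → ∀ (m : M) (c : C (n + 1)),
      DC n i (Submodule.Quotient.mk (m ⊗ₜ[k] c)) =
        Submodule.Quotient.mk (m ⊗ₜ[k] 𝒞.δ n i c)) :
    Nonempty (Homology0 (∑ i ∈ Finset.range 2, ((-1 : ℤ) ^ i) • hd 0 i) ≃ₗ[k]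
      Homology0 (∑ i ∈ Finset.range 2, ((-1 : ℤ) ^ i) • DC 0 i)) ∧
    ∀ n : ℕ, Nonempty (
      HomologySucc (∑ i ∈ Finset.range (n + 2), ((-1 : ℤ) ^ i) • hd n i)
          (∑ i ∈ Finset.range (n + 3), ((-1 : ℤ) ^ i) • hd (n + 1) i) ≃ₗ[k]
      HomologySucc (∑ i ∈ Finset.range (n + 2), ((-1 : ℤ) ^ i) • DC n i)
          (∑ i ∈ Finset.range (n + 3), ((-1 : ℤ) ^ i) • DC (n + 1) i)) := by
  obtain ⟨φ, hφ⟩ := hfe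
  have e₁ : ∀ n, (barEquiv hbact n).toLinearMap ∘ₗ coeffBoundary M ℬbar n =
      (∑ i ∈ Finset.range (n + 2), ((-1 : ℤ) ^ i) • hd n i) ∘ₗ
        (barEquiv hbact (n + 1)).toLinearMap := fun n =>
    barEquiv_comp_coeffBoundary hbδ hbact n (hd0 n) (hdmid n) (hdlast n)
  have e₂ : ∀ n, coeffBoundary M ℬbar n ∘ₗ (barEquiv hbact (n + 1)).symm.toLinearMap =
      (barEquiv hbact n).symm.toLinearMap ∘ₗ
        (∑ i ∈ Finset.range (n + 2), ((-1 : ℤ) ^ i) • hd n i) := fun n =>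
    LinearMap.ext fun x => (LinearEquiv.eq_symm_apply _).2 <| by
      simpa using LinearMap.congr_fun (e₁ n) ((barEquiv hbact (n + 1)).symm x)
  obtain ⟨⟨h₀⟩, hs⟩ := hφ.nonempty_homology_equiv (M := M)
  have e₃ : ∀ n, ∑ i ∈ Finset.range (n + 2), ((-1 : ℤ) ^ i) • DC n i = coeffBoundary M 𝒞 n :=
    fun n => sum_eq_coeffBoundary (hDC n)
  constructor
  · rw [e₃ 0]
    obtain ⟨e⟩ := nonempty_homology0_equiv _ _ _ _ (e₂ 0) (e₁ 0).symm
      (fun x => by simp) (fun x => by simp)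
    exact ⟨e.trans h₀⟩
  · intro n
    rw [e₃ n, e₃ (n + 1)]
    obtain ⟨e⟩ := nonempty_homologySucc_equiv _ _ _ _ _ _ (e₂ n) (e₂ (n + 1)) (e₁ n).symm
      (e₁ (n + 1)).symm (fun x _ => by simp) (fun x _ => by simp)
    obtain ⟨h⟩ := hs n
    exact ⟨e.trans h⟩
end
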